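/- arXiv:1606.01955 — 2 statements merged into one kernel-verified Lean document; each statement's English description precedes it below -/
import Mathlib

section
/- Let K be an algebraically closed field of characteristic zero and let p ∈ K[x,y] be a polynomial such that the quotient K-algebra K[x,y]/(p) is isomorphic as a K-algebra to the univariate polynomial ring K[t]. Then there exists a K-algebra automorphism φ of K[x,y] such that φ(p) = x. -/
section AMSSection
open Polynomial

/-- The data on which the degree argument runs. -/
structure AMSData (K F E : Type*) [Field K] [Field F] [Field E] where
  w : E → ℤ
  κ : K →+* F
  j : F →+* E
  g : E
  n : ℕ
  P : F[X]
  O : Subring F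
  w_mul : ∀ a b, a ≠ 0 → b ≠ 0 → w (a * b) = w a + w b
  w_add : ∀ a b, a ≠ 0 → b ≠ 0 → a + b ≠ 0 → w (a + b) ≤ max (w a) (w b)
  w_res : ∀ a b, a ≠ 0 → b ≠ 0 → w a = w b →
    ∃ c : K, c ≠ 0 ∧ (a - j (κ c) * b = 0 ∨ w (a - j (κ c) * b) < w a)
  w_κ : ∀ c : K, c ≠ 0 → w (j (κ c)) = 0
  n_pos : 0 < n
  wF : ∀ r, r ≠ 0 → (n : ℤ) ∣ w (j r)
  wF' : ∀ v : ℤ, ∃ r, r ≠ 0 ∧ w (j r) = n * v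
  P_monic : P.Monic
  P_deg : P.natDegree = n
  P_ev : P.eval₂ j g = 0
  inj : ∀ u : F[X], u ≠ 0 → u.degree < (n : ℕ) → u.eval₂ j g ≠ 0
  bdd : ∀ N < n, ∃ C : ℤ, ∀ R : F[X], R.Monic → R.natDegree = N → C ≤ w (R.eval₂ j g)
  κO : ∀ c, κ c ∈ O
  P_O : ∃ P' : O[X], P'.map O.subtype = P
  O_nonneg : ∀ H : O[X], (H.map O.subtype).eval₂ j g ≠ 0 →
    0 ≤ w ((H.map O.subtype).eval₂ j g)
  full : ∀ v : ℕ, ∃ H : O[X], (H.map O.subtype).degree < (n : ℕ) ∧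
    (H.map O.subtype).eval₂ j g ≠ 0 ∧ w ((H.map O.subtype).eval₂ j g) = v

namespace AMSData

variable {K F E : Type*} [Field K] [Field F] [Field E] (D : AMSData K F E)

/-- evaluation at `g` -/
noncomputable def ev : F[X] →+* E := eval₂RingHom D.j D.g

theorem ev_def (A : F[X]) : D.ev A = A.eval₂ D.j D.g := rfl

/-- degree of `A(g)` is at most `v` -/
def L (A : F[X]) (v : ℤ) : Prop := D.ev A = 0 ∨ D.w (D.ev A) ≤ v

variable {D}

theorem w_one : D.w 1 = 0 := by
  have := D.w_κ 1 one_ne_zero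
  simpa using this

theorem w_neg (a : E) (ha : a ≠ 0) : D.w (-a) = D.w a := by
  have h := D.w_mul (-1) (-1) (by simp) (by simp)
  have h2 := D.w_mul (-1) a (by simp) ha
  have h3 := w_one (D := D)
  simp at h h2
  rw [h3] at h
  omega

theorem L.mono {A : F[X]} {u v : ℤ} (h : D.L A u) (huv : u ≤ v) : D.L A v :=
  h.imp id (fun h => h.trans huv)

theorem L_zero (v : ℤ) : D.L 0 v := Or.inl (map_zero _)

theorem L.add {A B : F[X]} {v : ℤ} (hA : D.L A v) (hB : D.L B v) : D.L (A + B) v := by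
  unfold L at *
  rw [map_add]
  by_cases h1 : D.ev A = 0
  · simpa [h1] using hB
  by_cases h2 : D.ev B = 0
  · simpa [h2] using hA
  by_cases h3 : D.ev A + D.ev B = 0
  · exact Or.inl h3
  have := D.w_add _ _ h1 h2 h3
  have hA := hA.resolve_left h1
  have hB := hB.resolve_left h2
  right
  exact this.trans (max_le hA hB)

theorem L.mul {A B : F[X]} {u v : ℤ} (hA : D.L A u) (hB : D.L B v) : D.L (A * B) (u + v) := by
  unfold L at *
  rw [map_mul]
  by_cases h1 : D.ev A = 0
  · simp [h1]
  by_cases h2 : D.ev B = 0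
  · simp [h2]
  have hA := hA.resolve_left h1
  have hB := hB.resolve_left h2
  rw [D.w_mul _ _ h1 h2]
  right; omega

theorem L.neg {A : F[X]} {v : ℤ} (hA : D.L A v) : D.L (-A) v := by
  unfold L at *
  rw [map_neg]
  by_cases h1 : D.ev A = 0
  · simp [h1]
  have hA := hA.resolve_left h1
  rw [w_neg _ h1]
  exact Or.inr hA

theorem L.sub {A B : F[X]} {v : ℤ} (hA : D.L A v) (hB : D.L B v) : D.L (A - B) v := by
  rw [sub_eq_add_neg]; exact hA.add hB.neg

theorem ev_C (r : F) : D.ev (C r) = D.j r := by simp [ev]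

theorem L_κ (c : K) : D.L (C (D.κ c)) 0 := by
  by_cases h : c = 0
  · subst h; simpa using L_zero 0
  · right; rw [ev_C, D.w_κ c h]

theorem L_one : D.L 1 0 := by simpa using L_κ (D := D) 1

/-- if the degrees differ the degree of the sum is the max -/
theorem w_add_ne {a b : E} (ha : a ≠ 0) (hb : b ≠ 0) (h : D.w a ≠ D.w b) :
    a + b ≠ 0 ∧ D.w (a + b) = max (D.w a) (D.w b) := by
  have h0 : a + b ≠ 0 := by
    intro h0
    have : a = -b := eq_neg_of_add_eq_zero_left h0
    rw [this, w_neg b hb] at h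
    exact h rfl
  refine ⟨h0, ?_⟩
  have h1 := D.w_add a b ha hb h0
  have h2 := D.w_add (a + b) (-b) h0 (by simpa using hb) (by simpa using ha)
  have h3 := D.w_add (a + b) (-a) h0 (by simpa using ha) (by simpa using hb)
  rw [w_neg b hb] at h2
  rw [w_neg a ha] at h3
  simp only [add_neg_cancel_right] at h2
  have e : a + b + -a = b := by ring
  rw [e] at h3
  grind

/-- The filtration attached to `R` with weight `δ`. -/
inductive Fil (D : AMSData K F E) (R : F[X]) (N : ℕ) (δ : ℤ) : ℤ → F[X] → Prop
  | zero (v : ℤ) : Fil D R N δ v 0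
  | step (v : ℤ) (a A : F[X]) (ha : a.degree < (N : ℕ)) (hL : D.L a v)
      (hA : Fil D R N δ (v - δ) A) : Fil D R N δ v (a + R * A)

section fil
variable {R : F[X]} {N : ℕ} {δ : ℤ}

theorem Fil.base {a : F[X]} {v : ℤ} (ha : a.degree < (N : ℕ)) (hL : D.L a v) :
    D.Fil R N δ v a := by
  have := Fil.step (R := R) (δ := δ) v a 0 ha hL (Fil.zero _)
  simpa using this

theorem Fil.mulR {A : F[X]} {v : ℤ} (hA : D.Fil R N δ v A) : D.Fil R N δ (v + δ) (R * A) := by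
  have := Fil.step (D := D) (R := R) (N := N) (δ := δ) (v + δ) 0 A (by simp) (L_zero _)
    (by simpa using hA)
  simpa using this

theorem Fil.mono {A : F[X]} {u v : ℤ} (hA : D.Fil R N δ u A) (huv : u ≤ v) :
    D.Fil R N δ v A := by
  induction hA generalizing v with
  | zero => exact Fil.zero _
  | step u a A ha hL _ ih => exact Fil.step _ _ _ ha (hL.mono huv) (ih (by omega))

theorem Fil.add {A B : F[X]} {v : ℤ} (hA : D.Fil R N δ v A) (hB : D.Fil R N δ v B) :
    D.Fil R N δ v (A + B) := by
  induction hA generalizing B with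
  | zero => simpa using hB
  | step v a A ha hL _ ih =>
    cases hB with
    | zero => rw [add_zero]; exact Fil.step _ _ _ ha hL ‹_›
    | step _ b B hb hLb hB' =>
      have e : a + R * A + (b + R * B) = (a + b) + R * (A + B) := by ring
      rw [e]
      exact Fil.step _ _ _ ((degree_add_le _ _).trans_lt (max_lt ha hb)) (hL.add hLb) (ih hB')

theorem Fil.neg {A : F[X]} {v : ℤ} (hA : D.Fil R N δ v A) : D.Fil R N δ v (-A) := by
  induction hA with
  | zero => simpa using Fil.zero _
  | step v a A ha hL _ ih =>
    have e : -(a + R * A) = -a + R * (-A) := by ring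
    rw [e]
    exact Fil.step _ _ _ (by simpa using ha) hL.neg ih

theorem Fil.sub {A B : F[X]} {v : ℤ} (hA : D.Fil R N δ v A) (hB : D.Fil R N δ v B) :
    D.Fil R N δ v (A - B) := by
  rw [sub_eq_add_neg]; exact hA.add hB.neg

theorem Fil.toL (hR : D.L R δ) {A : F[X]} {v : ℤ} (hA : D.Fil R N δ v A) : D.L A v := by
  induction hA with
  | zero => exact L_zero _
  | step v a A ha hL _ ih => exact hL.add ((hR.mul ih).mono (by omega))

theorem Fil.powR (hN : 0 < N) (i : ℕ) : D.Fil R N δ (i * δ) (R ^ i) := by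
  induction i with
  | zero => simpa using Fil.base (by simpa using hN) (L_one (D := D))
  | succ i ih =>
    have := ih.mulR
    rw [pow_succ']
    refine this.mono (le_of_eq ?_)
    push_cast; ring

/-- The multiplication hypothesis. -/
def Mul (D : AMSData K F E) (R : F[X]) (N : ℕ) (δ : ℤ) : Prop :=
  ∀ (a b : F[X]) (u v : ℤ), a.degree < (N : ℕ) → b.degree < (N : ℕ) → D.L a u → D.L b v →
    D.Fil R N δ (u + v) (a * b)

theorem Fil.mul (hM : D.Mul R N δ) {A B : F[X]} {u v : ℤ} (hA : D.Fil R N δ u A)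
    (hB : D.Fil R N δ v B) : D.Fil R N δ (u + v) (A * B) := by
  have key : ∀ (a : F[X]) (u : ℤ), a.degree < (N : ℕ) → D.L a u →
      D.Fil R N δ (u + v) (a * B) := by
    intro a u ha hLa
    clear hA
    induction hB with
    | zero => simpa using Fil.zero _
    | step v b B hb hLb _ ih =>
      have e : a * (b + R * B) = a * b + R * (a * B) := by ring
      rw [e]
      exact (hM a b u v ha hb hLa hLb).add (ih.mulR.mono (by omega))
  induction hA with
  | zero => simpa using Fil.zero _
  | step u a A ha hLa _ ih =>
    have e : (a + R * A) * B = a * B + R * (A * B) := by ring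
    rw [e]
    exact (key a u ha hLa).add (ih.mulR.mono (by omega))

theorem Fil.pow (hM : D.Mul R N δ) (hN : 0 < N) {A : F[X]} {u : ℤ} (hA : D.Fil R N δ u A)
    (i : ℕ) : D.Fil R N δ (i * u) (A ^ i) := by
  induction i with
  | zero => simpa using Fil.base (by simpa using hN) (L_one (D := D))
  | succ i ih =>
    rw [pow_succ]
    refine (ih.mul hM hA).mono (le_of_eq ?_)
    push_cast; ring

theorem deg_eq {R : F[X]} {N : ℕ} (hR : R.Monic) (hN : R.natDegree = N) : R.degree = (N : ℕ) := by
  rw [degree_eq_natDegree hR.ne_zero, hN]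

/-- splitting off `R ^ k` -/
theorem Fil.split (hR : R.Monic) (hN : R.natDegree = N) (k : ℕ) {A : F[X]} {v : ℤ}
    (hA : D.Fil R N δ v A) : ∃ X Z : F[X], A = X + R ^ k * Z ∧ X.degree < (k * N : ℕ) ∧
      D.Fil R N δ (v - k * δ) Z := by
  induction k generalizing A v with
  | zero => exact ⟨0, A, by simp, by simp, by simpa using hA⟩
  | succ k ih =>
    cases hA with
    | zero => exact ⟨0, 0, by simp, by rw [degree_zero]; exact WithBot.bot_lt_coe _, Fil.zero _⟩
    | step _ a A ha hL hA =>
      obtain ⟨X, Z, rfl, hX, hZ⟩ := ih hA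
      refine ⟨a + R * X, Z, by ring, ?_, hZ.mono (by push_cast; linarith)⟩
      refine (degree_add_le _ _).trans_lt (max_lt (ha.trans_le ?_) ?_)
      · exact_mod_cast Nat.le_mul_of_pos_left N (Nat.succ_pos k)
      · rw [degree_mul, deg_eq hR hN, add_mul, one_mul, Nat.add_comm, Nat.cast_add]
        exact WithBot.add_lt_add_left (WithBot.natCast_ne_bot N) hX

theorem Fil.mod_div {A : F[X]} {v : ℤ}
    (hA : D.Fil R N δ v A) : ∃ a B : F[X], A = a + R * B ∧ a.degree < (N : ℕ) ∧ D.L a v ∧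
      D.Fil R N δ (v - δ) B := by
  cases hA with
  | zero => exact ⟨0, 0, by simp, by simp, L_zero _, Fil.zero _⟩
  | step _ a A ha hL hA => exact ⟨a, A, rfl, ha, hL, hA⟩

/-- changing the weight -/
theorem Fil.change (hR : R.Monic) (hN : R.natDegree = N) {δ' c : ℤ} (hc : 0 ≤ c)
    (hδ : δ + c ≤ δ') (m : ℕ) {A : F[X]} (hdeg : A.degree < (m * N : ℕ))
    (hA : D.Fil R N δ (m * δ) A) : D.Fil R N δ' (m * δ' - c) A := by
  induction m generalizing A with
  | zero =>
    have : A = 0 := by simpa using hdeg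
    subst this; exact Fil.zero _
  | succ m ih =>
    obtain ⟨a, B, rfl, ha, hL, hB⟩ := hA.mod_div
    have hBdeg : B.degree < (m * N : ℕ) := by
      by_contra hcon
      push Not at hcon
      have h1 : (((m + 1) * N : ℕ) : WithBot ℕ) ≤ (R * B).degree := by
        rw [degree_mul, deg_eq hR hN, add_mul, one_mul, Nat.add_comm, Nat.cast_add]
        gcongr
      have h2 : a.degree < (R * B).degree := by
        refine ha.trans_le (le_trans ?_ h1)
        exact_mod_cast Nat.le_mul_of_pos_left N (Nat.succ_pos m)
      rw [degree_add_eq_right_of_degree_lt h2] at hdeg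
      exact absurd hdeg (not_lt.mpr h1)
    have := ih hBdeg (hB.mono (by push_cast; linarith))
    refine Fil.step _ _ _ ha (hL.mono ?_) (this.mono (by push_cast; linarith))
    push_cast
    nlinarith

/-- transfer -/
theorem Fil.transfer (hM : D.Mul R N δ) {R2 : F[X]} {N2 : ℕ} {δ2 : ℤ}
    (hb : ∀ (a : F[X]) (u : ℤ), a.degree < (N2 : ℕ) → D.L a u → D.Fil R N δ u a)
    (h2 : D.Fil R N δ δ2 R2) {A : F[X]} {u : ℤ} (hA : D.Fil R2 N2 δ2 u A) :
    D.Fil R N δ u A := by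
  induction hA with
  | zero => exact Fil.zero _
  | step u a A ha hL _ ih => exact (hb a u ha hL).add ((h2.mul hM ih).mono (by omega))

/-- division -/
theorem Fil.div (hM : D.Mul R N δ) (hR : R.Monic) (hN : R.natDegree = N) (k : ℕ)
    {R2 r : F[X]} (hr : R2 = R ^ k + r)
    (hrdeg : r.degree < (k * N : ℕ)) (hrF : D.Fil R N δ (k * δ) r)
    {A : F[X]} {u : ℤ} (hA : D.Fil R N δ u A) :
    ∃ q s : F[X], A = s + R2 * q ∧ s.degree < (k * N : ℕ) ∧ D.Fil R N δ (u - k * δ) q := by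
  generalize hd : A.degree = d
  induction d using WellFoundedLT.induction generalizing A with
  | _ d ih =>
    obtain ⟨X, Z, hXZ, hX, hZ⟩ := hA.split hR hN k
    by_cases hZ0 : Z = 0
    · subst hZ0
      exact ⟨0, X, by simpa using hXZ, hX, Fil.zero _⟩
    have hdegA : A.degree = (k * N : ℕ) + Z.degree := by
      have h1 : (R ^ k * Z).degree = (k * N : ℕ) + Z.degree := by
        rw [degree_mul, deg_eq (hR.pow k) (by rw [hR.natDegree_pow, hN])]
      rw [hXZ, degree_add_eq_right_of_degree_lt, h1]
      rw [h1]
      refine hX.trans_le ?_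
      rw [degree_eq_natDegree hZ0]
      exact_mod_cast Nat.le_add_right _ _
    have hlt : (r * Z).degree < d := by
      rw [← hd, hdegA, degree_mul]
      exact WithBot.add_lt_add_right (degree_ne_bot.mpr hZ0) hrdeg
    obtain ⟨q, s, hqs, hs, hq⟩ := ih _ hlt ((hrF.mul hM hZ).mono (by omega : _ ≤ u)) rfl
    refine ⟨Z - q, X - s, ?_, (degree_sub_le _ _).trans_lt (max_lt hX hs), hZ.sub hq⟩
    have : R ^ k = R2 - r := by rw [hr]; ring
    rw [hXZ, this]
    linear_combination -hqs

end fil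
/-- A stage: polynomials of degree `< N` have degrees exactly the multiples of `e`. -/
structure Stage (D : AMSData K F E) (e N : ℕ) : Prop where
  he : 0 < e
  heN : e * N = D.n
  S1 : ∀ a : F[X], a.degree < (N : ℕ) → a ≠ 0 → (e : ℤ) ∣ D.w (D.ev a)
  S1' : ∀ v : ℤ, (e : ℤ) ∣ v → ∃ a : F[X], a.degree < (N : ℕ) ∧ a ≠ 0 ∧ D.w (D.ev a) = v

theorem ev_ne {a : F[X]} {N : ℕ} (hN : N ≤ D.n) (ha : a.degree < (N : ℕ)) (h0 : a ≠ 0) :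
    D.ev a ≠ 0 :=
  D.inj a h0 (ha.trans_le (by exact_mod_cast hN))

theorem ev_ne_monic {R : F[X]} {N : ℕ} (hN : N < D.n) (hR : R.Monic) (hd : R.natDegree = N) :
    D.ev R ≠ 0 :=
  D.inj R hR.ne_zero (by rw [deg_eq hR hd]; exact_mod_cast hN)

theorem Stage.N_pos {e N : ℕ} (S : D.Stage e N) : 0 < N := by
  rcases Nat.eq_zero_or_pos N with h | h
  · have := S.heN; have := D.n_pos; subst h; omega
  · exact h

theorem Stage.N_le {e N : ℕ} (S : D.Stage e N) : N ≤ D.n := by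
  rw [← S.heN]; exact Nat.le_mul_of_pos_left N S.he

theorem Stage.N_lt {e N : ℕ} (S : D.Stage e N) (he : 1 < e) : N < D.n := by
  rw [← S.heN]
  have := S.N_pos
  nlinarith

theorem stage_base : D.Stage D.n 1 where
  he := D.n_pos
  heN := by simp
  S1 a ha h0 := by
    have : a.degree ≤ 0 := by
      rw [degree_eq_natDegree h0] at ha ⊢
      have h2 : a.natDegree < 1 := by exact_mod_cast ha
      have h3 : a.natDegree = 0 := by omega
      rw [h3]; rfl
    rw [eq_C_of_degree_le_zero this, ev_C]
    apply D.wF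
    intro h
    apply h0
    rw [eq_C_of_degree_le_zero this, h, C_0]
  S1' v hv := by
    obtain ⟨x, rfl⟩ := hv
    obtain ⟨r, hr, hw⟩ := D.wF' x
    exact ⟨C r, by rw [degree_C hr]; simp, by simpa using hr, by rw [ev_C, hw]⟩

/-- A key polynomial for a stage. -/
structure Key (D : AMSData K F E) (e N k e' : ℕ) (R : F[X]) (δ : ℤ) : Prop where
  S : D.Stage e N
  hR : R.Monic
  hN : R.natDegree = N
  ev0 : D.ev R ≠ 0
  hw : D.w (D.ev R) = δ
  hnd : ¬ (e : ℤ) ∣ δ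
  hk : e = k * e'
  he' : (e' : ℤ) ∣ δ
  h1 : ∀ l : ℕ, (e : ℤ) ∣ l * δ → k ∣ l
  h2 : ∀ v : ℤ, (e' : ℤ) ∣ v → ∃ l : ℕ, l < k ∧ (e : ℤ) ∣ v - l * δ

theorem key_exists {e N : ℕ} (S : D.Stage e N) {R : F[X]} (hR : R.Monic) (hN : R.natDegree = N)
    (ev0 : D.ev R ≠ 0) (hnd : ¬ (e : ℤ) ∣ D.w (D.ev R)) :
    ∃ k e' : ℕ, D.Key e N k e' R (D.w (D.ev R)) := by
  set δ := D.w (D.ev R) with hδ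
  have hepos := S.he
  obtain ⟨k, hk⟩ : Int.gcd e δ ∣ e := by
    have := Int.gcd_dvd_left (e : ℤ) δ
    exact_mod_cast this
  obtain ⟨d, hd⟩ := Int.gcd_dvd_right (e : ℤ) δ
  set e' := Int.gcd e δ with he'
  have he'pos : 0 < e' := Nat.pos_of_ne_zero (by rintro h; rw [h] at hk; omega)
  have hkpos : 0 < k := Nat.pos_of_ne_zero (by rintro h; rw [h] at hk; omega)
  have hcop : IsCoprime (k : ℤ) d := by
    have hb := Int.gcd_eq_gcd_ab (e : ℤ) δ
    rw [← he'] at hb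
    refine ⟨Int.gcdA e δ, Int.gcdB e δ, ?_⟩
    have h0 : (e' : ℤ) ≠ 0 := by exact_mod_cast he'pos.ne'
    apply mul_left_cancel₀ h0
    have hk' : (e : ℤ) = e' * k := by exact_mod_cast hk
    have : (e' : ℤ) = (e' * k) * Int.gcdA e δ + (e' * d) * Int.gcdB e δ := by
      rw [← hk', ← hd]; exact hb
    linear_combination -this
  have h0 : (e' : ℤ) ≠ 0 := by exact_mod_cast he'pos.ne'
  have hk' : (e : ℤ) = e' * k := by exact_mod_cast hk
  refine ⟨k, e', S, hR, hN, ev0, rfl, hnd, by rw [hk, mul_comm], ⟨d, hd⟩, ?_, ?_⟩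
  · intro l hl
    rw [hk', hd, show (l : ℤ) * (e' * d) = e' * (l * d) by ring] at hl
    have := Int.dvd_of_mul_dvd_mul_left h0 hl
    have := hcop.dvd_of_dvd_mul_right this
    exact_mod_cast this
  · rintro v ⟨x, rfl⟩
    obtain ⟨a, b, hab⟩ := hcop
    have hk0 : (k : ℤ) ≠ 0 := by exact_mod_cast hkpos.ne'
    refine ⟨((x * b) % k).toNat, ?_, ?_⟩
    · have := Int.emod_lt_of_pos (x * b) (by exact_mod_cast hkpos : (0 : ℤ) < k)
      have := Int.emod_nonneg (x * b) hk0
      omega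
    · rw [Int.toNat_of_nonneg (Int.emod_nonneg _ hk0), hk', hd]
      refine ⟨x * a + (x * b / k) * d, ?_⟩
      have := Int.emod_add_mul_ediv (x * b) k
      have e1 : x * b % k = x * b - k * (x * b / k) := by linarith
      rw [e1]
      linear_combination -(e' * x) * hab

section key
variable {e N k e' : ℕ} {R : F[X]} {δ : ℤ}

theorem Key.LR (H : D.Key e N k e' R δ) : D.L R δ := Or.inr H.hw.le

theorem Key.k_two (H : D.Key e N k e' R δ) : 2 ≤ k := by
  have := H.hk
  have h1 := H.S.he
  rcases k with _ | _ | k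
  · omega
  · exact absurd H.he' (by rw [show e' = e by omega]; exact H.hnd)
  · omega

theorem Key.e'_pos (H : D.Key e N k e' R δ) : 0 < e' := by
  have := H.hk
  have h1 := H.S.he
  exact Nat.pos_of_ne_zero (by rintro rfl; omega)

theorem Key.e'_lt (H : D.Key e N k e' R δ) : e' < e := by
  have := H.hk
  have h1 := H.k_two
  have := H.e'_pos
  nlinarith

theorem Key.heN (H : D.Key e N k e' R δ) : e' * (k * N) = D.n := by
  rw [← H.S.heN, H.hk]; ring

theorem Key.kN_le (H : D.Key e N k e' R δ) : k * N ≤ D.n := by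
  rw [← H.heN]; exact Nat.le_mul_of_pos_left _ H.e'_pos

/-- degree bookkeeping of a quotient -/
theorem quot_deg {R a B : F[X]} {N i : ℕ} (hR : R.Monic) (hN : R.natDegree = N)
    (ha : a.degree < (N : ℕ)) (h : (a + R * B).degree < (((i + 1) * N : ℕ) : WithBot ℕ)) :
    B.degree < (i * N : ℕ) := by
  by_contra hcon
  push Not at hcon
  have h1 : (((i + 1) * N : ℕ) : WithBot ℕ) ≤ (R * B).degree := by
    rw [degree_mul, deg_eq hR hN, add_mul, one_mul, Nat.add_comm, Nat.cast_add]
    gcongr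
  have h2 : a.degree < (R * B).degree := by
    refine ha.trans_le (le_trans ?_ h1)
    exact_mod_cast Nat.le_mul_of_pos_left N (Nat.succ_pos i)
  rw [degree_add_eq_right_of_degree_lt h2] at h
  exact absurd h (not_lt.mpr h1)

theorem exists_div {R : F[X]} {N : ℕ} (hR : R.Monic) (hN : R.natDegree = N) (A : F[X]) :
    ∃ a B : F[X], A = a + R * B ∧ a.degree < (N : ℕ) :=
  ⟨A %ₘ R, A /ₘ R, (modByMonic_add_div A R).symm, by
    rw [← deg_eq hR hN]; exact degree_modByMonic_lt A hR⟩

/-- Fundamental decomposition. -/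
theorem Key.decomp (H : D.Key e N k e' R δ) (i : ℕ) (hi : i ≤ k) (A : F[X])
    (hA : A.degree < (i * N : ℕ)) (h0 : A ≠ 0) :
    D.ev A ≠ 0 ∧ D.Fil R N δ (D.w (D.ev A)) A ∧
      ∃ l : ℕ, l < i ∧ (e : ℤ) ∣ D.w (D.ev A) - l * δ := by
  induction i generalizing A with
  | zero => exact absurd (by simpa using hA) h0
  | succ i ih =>
    obtain ⟨a, B, rfl, ha⟩ := exists_div H.hR H.hN A
    have hB := quot_deg H.hR H.hN ha hA
    by_cases hB0 : B = 0
    · subst hB0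
      simp only [mul_zero, add_zero] at h0 ⊢
      exact ⟨ev_ne H.S.N_le ha h0, Fil.base ha (Or.inr le_rfl), 0, by omega,
        by simpa using H.S.S1 a ha h0⟩
    obtain ⟨hB1, hB2, l, hl, hl2⟩ := ih (by omega) B hB hB0
    have hwRB : D.w (D.ev (R * B)) = δ + D.w (D.ev B) := by
      rw [map_mul, D.w_mul _ _ H.ev0 hB1, H.hw]
    have hRB0 : D.ev (R * B) ≠ 0 := by rw [map_mul]; exact mul_ne_zero H.ev0 hB1
    have hl3 : (e : ℤ) ∣ D.w (D.ev (R * B)) - (l + 1 : ℕ) * δ := by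
      rw [hwRB]; push_cast
      have e1 : δ + D.w (D.ev B) - ((l : ℤ) + 1) * δ = D.w (D.ev B) - l * δ := by ring
      rw [e1]; exact hl2
    by_cases ha0 : a = 0
    · subst ha0
      simp only [zero_add]
      refine ⟨hRB0, ?_, l + 1, by omega, hl3⟩
      rw [hwRB]
      exact hB2.mulR.mono (by omega)
    have hea := ev_ne H.S.N_le ha ha0
    have hda := H.S.S1 a ha ha0
    have hne : D.w (D.ev a) ≠ D.w (D.ev (R * B)) := by
      intro h
      rw [← h] at hl3
      have := (Int.dvd_iff_dvd_of_dvd_sub hl3).mp hda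
      have := Nat.le_of_dvd (by omega) (H.h1 _ this)
      omega
    obtain ⟨hs0, hs⟩ := w_add_ne hea hRB0 hne
    rw [← map_add] at hs0 hs
    refine ⟨hs0, ?_, ?_⟩
    · refine Fil.step _ _ _ ha (Or.inr ?_) (hB2.mono ?_)
      · rw [hs]; exact le_max_left _ _
      · rw [hs]; have := le_max_right (D.w (D.ev a)) (D.w (D.ev (R * B))); omega
    · rcases max_choice (D.w (D.ev a)) (D.w (D.ev (R * B))) with h | h
      · exact ⟨0, by omega, by rw [hs, h]; simpa using hda⟩
      · exact ⟨l + 1, by omega, by rw [hs, h]; exact hl3⟩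

theorem Key.fil (H : D.Key e N k e' R δ) (a : F[X]) (u : ℤ) (ha : a.degree < (k * N : ℕ))
    (hL : D.L a u) : D.Fil R N δ u a := by
  by_cases h0 : a = 0
  · subst h0; exact Fil.zero _
  obtain ⟨h1, h2, -⟩ := H.decomp k le_rfl a ha h0
  exact h2.mono (hL.resolve_left h1)

theorem Key.stage (H : D.Key e N k e' R δ) : D.Stage e' (k * N) where
  he := H.e'_pos
  heN := H.heN
  S1 a ha h0 := by
    obtain ⟨-, -, l, -, h⟩ := H.decomp k le_rfl a ha h0
    have h1 : (e' : ℤ) ∣ e := ⟨k, by rw [H.hk]; push_cast; ring⟩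
    have h2 := h1.trans h
    exact (Int.dvd_iff_dvd_of_dvd_sub h2).mpr (H.he'.mul_left _)
  S1' v hv := by
    obtain ⟨l, hl, hd⟩ := H.h2 v hv
    obtain ⟨a, ha, ha0, hw⟩ := H.S.S1' _ hd
    have hea := ev_ne H.S.N_le ha ha0
    have hp : ∀ i : ℕ, D.w (D.ev R ^ i) = i * δ := by
      intro i
      induction i with
      | zero => simpa using w_one
      | succ i ih =>
        rw [pow_succ, D.w_mul _ _ (pow_ne_zero _ H.ev0) H.ev0, ih, H.hw]; push_cast; ring
    refine ⟨a * R ^ l, ?_, mul_ne_zero ha0 (pow_ne_zero _ H.hR.ne_zero), ?_⟩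
    · rw [degree_mul, deg_eq (H.hR.pow l) (by rw [H.hR.natDegree_pow, H.hN])]
      have h1 : N + l * N ≤ k * N := by nlinarith
      have h2 : ((N + l * N : ℕ) : WithBot ℕ) ≤ (k * N : ℕ) := by exact_mod_cast h1
      refine lt_of_lt_of_le ?_ h2
      rw [Nat.cast_add]
      exact WithBot.add_lt_add_right (WithBot.natCast_ne_bot _) ha
    · rw [map_mul, map_pow, D.w_mul _ _ hea (pow_ne_zero _ H.ev0), hw, hp]; ring

theorem Key.mul (H : D.Key e N k e' R δ) : D.Mul R N δ := by
  intro a b u v ha hb hLa hLb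
  by_cases ha0 : a = 0
  · subst ha0; simpa using Fil.zero _
  by_cases hb0 : b = 0
  · subst hb0; simpa using Fil.zero _
  apply H.fil _ _ _ (hLa.mul hLb)
  rw [degree_mul]
  have h1 : N + N ≤ k * N := by have := H.k_two; nlinarith
  have h2 : ((N + N : ℕ) : WithBot ℕ) ≤ (k * N : ℕ) := by exact_mod_cast h1
  refine lt_of_lt_of_le ?_ h2
  rw [Nat.cast_add]
  exact (WithBot.add_lt_add_right (degree_ne_bot.mpr hb0) ha).trans
    (WithBot.add_lt_add_left (WithBot.natCast_ne_bot _) hb)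

end key

theorem deg_sub_monic {R a : F[X]} {N : ℕ} (hR : R.Monic) (hN : R.natDegree = N)
    (ha : a.degree < (N : ℕ)) : (R - a).Monic ∧ (R - a).natDegree = N := by
  have h : a.degree < R.degree := by rwa [deg_eq hR hN]
  refine ⟨hR.sub_of_left h, ?_⟩
  rw [natDegree_eq_of_degree_eq (degree_sub_eq_left_of_degree_lt h), hN]

theorem deg_sub_lt {A B : F[X]} {m : ℕ} (hA : A.degree < (m : ℕ)) (hB : B.degree < (m : ℕ)) :
    (A - B).degree < (m : ℕ) := (degree_sub_le _ _).trans_lt (max_lt hA hB)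

theorem deg_add_lt {A B : F[X]} {m : ℕ} (hA : A.degree < (m : ℕ)) (hB : B.degree < (m : ℕ)) :
    (A + B).degree < (m : ℕ) := (degree_add_le _ _).trans_lt (max_lt hA hB)

theorem deg_Cmul_lt {A : F[X]} {m : ℕ} (c : F) (hA : A.degree < (m : ℕ)) :
    (C c * A).degree < (m : ℕ) := by
  refine lt_of_le_of_lt ?_ hA
  rw [← smul_eq_C_mul]; exact degree_smul_le c A

theorem deg_monic_sub {A B : F[X]} {m : ℕ} (hA : A.Monic) (hB : B.Monic) (h1 : A.natDegree = m)
    (h2 : B.natDegree = m) : (A - B).degree < (m : ℕ) := by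
  rw [← deg_eq hA h1]
  refine degree_sub_lt_left ?_ hA.ne_zero ?_
  · rw [deg_eq hA h1, deg_eq hB h2]
  · rw [hA.leadingCoeff, hB.leadingCoeff]

/-- lowering by residues -/
theorem res {R a : F[X]} (hR0 : D.ev R ≠ 0) (ha0 : D.ev a ≠ 0) (hw : D.w (D.ev R) = D.w (D.ev a)) :
    ∃ c : K, c ≠ 0 ∧ D.L (R - C (D.κ c) * a) (D.w (D.ev R) - 1) := by
  obtain ⟨c, hc, h⟩ := D.w_res _ _ hR0 ha0 hw
  refine ⟨c, hc, ?_⟩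
  unfold L
  rw [map_sub, map_mul, ev_C]
  rcases h with h | h
  · exact Or.inl h
  · right; omega

theorem refine_aux {e N : ℕ} (S : D.Stage e N) (he : 1 < e) (B : ℤ)
    (hB : ∀ R : F[X], R.Monic → R.natDegree = N → B ≤ D.w (D.ev R)) (m : ℕ) :
    ∀ R : F[X], R.Monic → R.natDegree = N → (D.w (D.ev R) - B).toNat = m →
    ∃ a : F[X], a.degree < (N : ℕ) ∧ D.L a (D.w (D.ev R)) ∧
      D.w (D.ev (R - a)) ≤ D.w (D.ev R) ∧ ¬ (e : ℤ) ∣ D.w (D.ev (R - a)) := by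
  induction m using Nat.strong_induction_on with
  | _ m ih =>
    intro R hR hN hm
    by_cases hd : (e : ℤ) ∣ D.w (D.ev R)
    · obtain ⟨a, ha, ha0, hw⟩ := S.S1' _ hd
      have hR0 := ev_ne_monic (S.N_lt he) hR hN
      have hea := ev_ne S.N_le ha ha0
      obtain ⟨c, hc, hL⟩ := res hR0 hea hw.symm
      have ha' := deg_Cmul_lt (D.κ c) ha
      obtain ⟨h1, h2⟩ := deg_sub_monic hR hN ha'
      have h3 := hL.resolve_left (ev_ne_monic (S.N_lt he) h1 h2)
      have h4 := hB _ h1 h2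
      obtain ⟨b, hb, hLb, hle, hnd⟩ := ih _ (by omega) _ h1 h2 rfl
      refine ⟨C (D.κ c) * a + b, deg_add_lt ha' hb, ?_, ?_, ?_⟩
      · refine L.add ?_ (hLb.mono (by omega))
        have := (L_κ (D := D) c).mul (Or.inr hw.le : D.L a _)
        simpa using this
      · rw [← sub_sub]; omega
      · rw [← sub_sub]; exact hnd
    · exact ⟨0, by simp, L_zero _, by simp, by simpa using hd⟩

theorem refine' {e N : ℕ} (S : D.Stage e N) (he : 1 < e) {R : F[X]} (hR : R.Monic)
    (hN : R.natDegree = N) :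
    ∃ a : F[X], a.degree < (N : ℕ) ∧ D.L a (D.w (D.ev R)) ∧
      D.w (D.ev (R - a)) ≤ D.w (D.ev R) ∧ ¬ (e : ℤ) ∣ D.w (D.ev (R - a)) := by
  obtain ⟨B, hB⟩ := D.bdd N (S.N_lt he)
  exact refine_aux S he B hB _ R hR hN rfl

theorem w_pow {x : E} (hx : x ≠ 0) (i : ℕ) : D.w (x ^ i) = i * D.w x := by
  induction i with
  | zero => simpa using w_one
  | succ i ih =>
    rw [pow_succ, D.w_mul _ _ (pow_ne_zero _ hx) hx, ih]; push_cast; ring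

theorem claim (e : ℕ) : ∀ (N : ℕ), D.Stage e N → ∀ (R : F[X]) (δ : ℤ), R.Monic →
    R.natDegree = N → D.L R δ → (e = 1 ∨ (D.w (D.ev R) = δ ∧ ¬ (e : ℤ) ∣ δ)) →
    D.Fil R N δ (e * δ) D.P := by
  induction e using Nat.strong_induction_on with
  | _ e ih =>
    intro N S R δ hR hN hL hcase
    by_cases he1 : e = 1
    · subst he1
      have hNn : N = D.n := by have := S.heN; omega
      have hdeg : (D.P - R).degree < (N : ℕ) :=
        deg_monic_sub D.P_monic hR (by rw [D.P_deg, hNn]) hN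
      have hLP : D.L D.P δ := Or.inl D.P_ev
      have h := Fil.step (R := R) (δ := δ) (N := N) (((1 : ℕ) : ℤ) * δ) (D.P - R) 1 hdeg
        ((hLP.sub hL).mono (by simp)) (by
          have := Fil.powR (D := D) (R := R) (δ := δ) S.N_pos 0
          simpa using this)
      simpa using h
    · have he : 1 < e := by have := S.he; omega
      obtain ⟨rfl, hnd⟩ := hcase.resolve_left he1
      obtain ⟨k, e', H⟩ := key_exists S hR hN (ev_ne_monic (S.N_lt he) hR hN) hnd
      set δ := D.w (D.ev R) with hδ
      have hRk := hR.pow k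
      have hRkN : (R ^ k).natDegree = k * N := by rw [hR.natDegree_pow, hN]
      have hkδ : D.w (D.ev (R ^ k)) = k * δ := by rw [map_pow, w_pow H.ev0]
      have hee : (e : ℤ) = k * e' := by exact_mod_cast H.hk
      -- a polynomial R2
      obtain ⟨R2, δ2, hR2, hR2N, hR2F, hδ2, hfil⟩ : ∃ (R2 : F[X]) (δ2 : ℤ), R2.Monic ∧
          R2.natDegree = k * N ∧ D.Fil R N δ (k * δ) R2 ∧ δ2 ≤ k * δ ∧
          D.Fil R2 (k * N) δ2 (e' * δ2) D.P := by
        by_cases he'1 : e' = 1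
        · exact ⟨R ^ k, k * δ, hRk, hRkN, Fil.powR S.N_pos k, le_rfl,
            ih e' H.e'_lt _ H.stage _ _ hRk hRkN (Or.inr hkδ.le) (Or.inl he'1)⟩
        · obtain ⟨a, ha, hLa, hle, hnd'⟩ := refine' H.stage (by have := H.e'_pos; omega) hRk hRkN
          obtain ⟨h1, h2⟩ := deg_sub_monic hRk hRkN ha
          rw [hkδ] at hle hLa
          exact ⟨R ^ k - a, _, h1, h2, (Fil.powR S.N_pos k).sub (H.fil a _ ha hLa), hle,
            ih e' H.e'_lt _ H.stage _ _ h1 h2 (Or.inr le_rfl) (Or.inr ⟨rfl, hnd'⟩)⟩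
      have hkN : 0 < k * N := H.stage.N_pos
      have hA : (D.P - R2 ^ e').degree < (e' * (k * N) : ℕ) :=
        deg_monic_sub D.P_monic (hR2.pow e') (by rw [D.P_deg, H.heN])
          (by rw [hR2.natDegree_pow, hR2N])
      have hAF := (hfil.sub (Fil.powR hkN e')).change hR2 hR2N le_rfl
        (by simpa using hδ2) e' hA
      have h3 := Fil.transfer H.mul H.fil hR2F hAF
      have h4 := Fil.pow H.mul S.N_pos hR2F e'
      have h5 := h3.add (h4.mono (by simp))
      rw [sub_add_cancel] at h5
      refine h5.mono (le_of_eq ?_)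
      rw [hee]; ring

theorem eq_C_of_lt_one {a : F[X]} (ha : a.degree < ((1 : ℕ) : WithBot ℕ)) : ∃ c, a = C c := by
  by_cases h0 : a = 0
  · exact ⟨0, by simpa using h0⟩
  have : a.degree ≤ 0 := by
    rw [degree_eq_natDegree h0] at ha ⊢
    have h2 : a.natDegree < 1 := by exact_mod_cast ha
    have h3 : a.natDegree = 0 := by omega
    rw [h3]; rfl
  exact ⟨_, eq_C_of_degree_le_zero this⟩

theorem deg_mul_lt {a b : F[X]} {N M : ℕ} (ha : a.degree < (N : ℕ)) (hb : b.degree < (M : ℕ)) :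
    (a * b).degree < (N + M : ℕ) := by
  by_cases hb0 : b = 0
  · subst hb0; rw [mul_zero, degree_zero]; exact WithBot.bot_lt_coe _
  rw [degree_mul, Nat.cast_add]
  exact (WithBot.add_lt_add_right (degree_ne_bot.mpr hb0) ha).trans
    (WithBot.add_lt_add_left (WithBot.natCast_ne_bot _) hb)

theorem deg_mul_lt' {a b : F[X]} {N M : ℕ} (ha : a.Monic) (haN : a.natDegree = N)
    (hb : b.degree < (M : ℕ)) :
    (a * b).degree < (N + M : ℕ) := by
  rw [degree_mul, Nat.cast_add, deg_eq ha haN]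
  exact WithBot.add_lt_add_left (WithBot.natCast_ne_bot _) hb

theorem mul_of_div {R : F[X]} {N : ℕ} {δ : ℤ} (hR : R.Monic) (hN : R.natDegree = N)
    (hL : D.L R δ) (h : ∀ (a b : F[X]) (u v : ℤ), a.degree < (N : ℕ) → b.degree < (N : ℕ) →
      D.L a u → D.L b v → ∃ r q, a * b = r + R * q ∧ r.degree < (N : ℕ) ∧ D.L q (u + v - δ)) :
    D.Mul R N δ := by
  intro a b u v ha hb hLa hLb
  obtain ⟨r, q, hab, hr, hq⟩ := h a b u v ha hb hLa hLb
  have h1 := deg_mul_lt ha hb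
  have hqd : q.degree < (1 * N : ℕ) := by
    apply quot_deg hR hN hr
    rw [← hab, show (1 + 1) * N = N + N by ring]; exact h1
  have hLr : D.L r (u + v) := by
    have : r = a * b - R * q := by rw [hab]; ring
    rw [this]
    exact (hLa.mul hLb).sub ((hL.mul hq).mono (by omega))
  rw [hab]
  exact Fil.step _ _ _ hr hLr (Fil.base (by simpa using hqd) hq)

/-- A stage with a weak multiplication property. -/
def Good (D : AMSData K F E) (e N : ℕ) : Prop := 1 < e → ∃ B : ℤ,
  (∃ R' : D.O[X], (R'.map D.O.subtype).Monic ∧ (R'.map D.O.subtype).natDegree = N ∧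
    D.w (D.ev (R'.map D.O.subtype)) ≤ B) ∧
  ∀ R : F[X], R.Monic → R.natDegree = N → D.w (D.ev R) ≤ B → (e : ℤ) ∣ D.w (D.ev R) →
    D.Mul R N (D.w (D.ev R)) ∧ ∃ a : F[X], a.degree < (N : ℕ) ∧ a ≠ 0 ∧
      D.w (D.ev a) = D.w (D.ev R) ∧ ∃ r q, a * a = r + R * q ∧ r.degree < (N : ℕ) ∧
        D.L q (D.w (D.ev R) - 1)

theorem good_base : D.Good D.n 1 := by
  intro he
  have hsq : ∀ a b : F[X], a.degree < ((1 : ℕ) : WithBot ℕ) → b.degree < ((1 : ℕ) : WithBot ℕ) →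
      (a * b).degree < ((1 : ℕ) : WithBot ℕ) := by
    intro a b ha hb
    obtain ⟨c, rfl⟩ := eq_C_of_lt_one ha
    exact deg_Cmul_lt c hb
  refine ⟨_, ⟨X, by simp, by simp, le_rfl⟩, ?_⟩
  intro R hR hN _ hd
  refine ⟨mul_of_div hR hN (Or.inr le_rfl) ?_, ?_⟩
  · intro a b u v ha hb _ _
    exact ⟨a * b, 0, by simp, hsq a b ha hb, L_zero _⟩
  · obtain ⟨a, ha, ha0, hw⟩ := stage_base.S1' _ hd
    exact ⟨a, ha, ha0, hw, a * a, 0, by simp, hsq a a ha ha, L_zero _⟩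

theorem good_step {e N k e' : ℕ} {Q' : D.O[X]} {δ : ℤ}
    (H : D.Key e N k e' (Q'.map D.O.subtype) δ) : D.Good e' (k * N) := by
  intro he'
  set Q := Q'.map D.O.subtype with hQ
  have hQk := H.hR.pow k
  have hQkN : (Q ^ k).natDegree = k * N := by rw [H.hR.natDegree_pow, H.hN]
  have hkδ : D.w (D.ev (Q ^ k)) = k * δ := by rw [map_pow, w_pow H.ev0, H.hw]
  refine ⟨k * δ, ⟨Q' ^ k, ?_, ?_, ?_⟩, ?_⟩
  · rw [Polynomial.map_pow]; exact hQk
  · rw [Polynomial.map_pow]; exact hQkN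
  · rw [Polynomial.map_pow]; exact hkδ.le
  intro R hR hN hle hd
  have hLR : D.L R (k * δ) := Or.inr hle
  have hrd := deg_monic_sub hR hQk hN hQkN
  have hrF := H.fil _ _ hrd (hLR.sub (Or.inr hkδ.le))
  have hdiv : ∀ (a b : F[X]) (u v : ℤ), a.degree < (k * N : ℕ) → b.degree < (k * N : ℕ) →
      D.L a u → D.L b v → ∃ r q, a * b = r + R * q ∧ r.degree < (k * N : ℕ) ∧
        D.L q (u + v - k * δ) := by
    intro a b u v ha hb hLa hLb
    have h1 := (H.fil a u ha hLa).mul H.mul (H.fil b v hb hLb)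
    obtain ⟨q, s, h2, h3, h4⟩ := Fil.div H.mul H.hR H.hN k (R2 := R) (by ring) hrd hrF h1
    exact ⟨s, q, h2, h3, h4.toL H.LR⟩
  refine ⟨mul_of_div hR hN (Or.inr le_rfl) ?_, ?_⟩
  · intro a b u v ha hb hLa hLb
    obtain ⟨r, q, h1, h2, h3⟩ := hdiv a b u v ha hb hLa hLb
    exact ⟨r, q, h1, h2, h3.mono (by omega)⟩
  · rcases hle.lt_or_eq with hlt | heq
    · obtain ⟨a, ha, ha0, hw⟩ := H.stage.S1' _ hd
      obtain ⟨r, q, h1, h2, h3⟩ := hdiv a a _ _ ha ha (Or.inr hw.le) (Or.inr hw.le)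
      exact ⟨a, ha, ha0, hw, r, q, h1, h2, h3.mono (by omega)⟩
    · have hed : (e : ℤ) ∣ k * δ := by
        rw [H.hk]; push_cast
        exact mul_dvd_mul_left _ H.he'
      obtain ⟨a, ha, ha0, hw⟩ := H.S.S1' _ hed
      have hk2 : N + N ≤ k * N := by have := H.k_two; nlinarith
      refine ⟨a, ha.trans_le ?_, ha0, hw.trans heq.symm, a * a, 0, by simp,
        (deg_mul_lt ha ha).trans_le (by exact_mod_cast hk2), L_zero _⟩
      exact_mod_cast (by omega : N ≤ k * N)

section star
variable {R : F[X]} {N : ℕ} {δ : ℤ}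

theorem Fil.smul (c : K) {A : F[X]} {v : ℤ} (hA : D.Fil R N δ v A) :
    D.Fil R N δ v (C (D.κ c) * A) := by
  induction hA with
  | zero => simpa using Fil.zero _
  | step v a A ha hL _ ih =>
    have e : C (D.κ c) * (a + R * A) = C (D.κ c) * a + R * (C (D.κ c) * A) := by ring
    rw [e]
    exact Fil.step _ _ _ (deg_Cmul_lt _ ha) (((L_κ c).mul hL).mono (by simp)) ih

theorem Fil.nsmul (c : ℕ) {A : F[X]} {v : ℤ} (hA : D.Fil R N δ v A) :
    D.Fil R N δ v ((c : F[X]) * A) := by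
  have := hA.smul (c : K)
  simpa using this

theorem Fil.pow_diff (hM : D.Mul R N δ) (hN : 0 < N) {U d : F[X]} (hU : D.Fil R N δ δ U)
    (hd : D.Fil R N δ (δ - 1) d) (i : ℕ) : D.Fil R N δ (i * δ - 1) ((U - d) ^ i - U ^ i) := by
  induction i with
  | zero => simpa using Fil.zero _
  | succ i ih =>
    have e : (U - d) ^ (i + 1) - U ^ (i + 1) =
        ((U - d) ^ i - U ^ i) * (U - d) - U ^ i * d := by ring
    rw [e]
    refine ((ih.mul hM (hU.sub (hd.mono (by omega)))).mono ?_).sub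
      (((Fil.pow hM hN hU i).mul hM hd).mono ?_) <;> push_cast <;> linarith

theorem pow_expand (hM : D.Mul R N δ) (hR : R.Monic) (hN : R.natDegree = N) (hN0 : 0 < N)
    {a r q : F[X]} (ha : a.degree < (N : ℕ)) (hLa : D.L a δ) (haa : a * a = r + R * q)
    (hr : r.degree < (N : ℕ)) (hq : q.degree < (N : ℕ)) (hLq : D.L q (δ - 1)) (i : ℕ) :
    ∃ X Y : F[X], (R - a) ^ (i + 1) = R ^ (i + 1) - ((i + 1 : ℕ) : F[X]) * a * R ^ i + X + Y ∧
      X.degree < (i * N : ℕ) ∧ D.Fil R N δ ((i + 1 : ℕ) * δ - 1) Y := by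
  induction i with
  | zero => exact ⟨0, 0, by simp, by simp, Fil.zero _⟩
  | succ i ih =>
    obtain ⟨X, Y, hXY, hX, hY⟩ := ih
    have hRF : D.Fil R N δ δ R := by simpa using Fil.powR (D := D) (R := R) (δ := δ) hN0 1
    refine ⟨R * X - a * X + ((i + 1 : ℕ) : F[X]) * (r * R ^ i),
      (R - a) * Y + ((i + 1 : ℕ) : F[X]) * (q * R ^ (i + 1)), ?_, ?_, ?_⟩
    · rw [pow_succ, hXY]
      push_cast
      linear_combination ((i : F[X]) + 1) * R ^ i * haa
    · have e1 : (i + 1) * N = N + i * N := by ring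
      have h1 := deg_mul_lt' hR hN hX
      have h2 := deg_mul_lt ha hX
      have h3 := deg_mul_lt' (hR.pow i) (by rw [hR.natDegree_pow, hN]) hr
      rw [e1]
      refine deg_add_lt (deg_sub_lt h1 h2) ?_
      rw [mul_comm r, show ((i + 1 : ℕ) : F[X]) = C ((i + 1 : ℕ) : F) by simp]
      apply deg_Cmul_lt
      rwa [Nat.add_comm] at h3
    · refine (((hRF.sub (Fil.base ha hLa)).mul hM hY).mono ?_).add
        ((((Fil.base hq hLq).mul hM (Fil.powR hN0 (i + 1))).nsmul _).mono ?_)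
      · push_cast; linarith
      · push_cast; linarith

end star

theorem star [CharZero K] {e N : ℕ} (S : D.Stage e N) (G : D.Good e N) (he : 1 < e) :
    ∃ Q' : D.O[X], (Q'.map D.O.subtype).Monic ∧ (Q'.map D.O.subtype).natDegree = N ∧
      ¬ (e : ℤ) ∣ D.w (D.ev (Q'.map D.O.subtype)) := by
  obtain ⟨B, ⟨R0, hR0, hR0N, hR0B⟩, hG⟩ := G he
  have hinj : Function.Injective D.O.subtype := Subtype.val_injective
  suffices h : ∀ (m : ℕ) (R' : D.O[X]), (R'.map D.O.subtype).Monic →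
      (R'.map D.O.subtype).natDegree = N → D.w (D.ev (R'.map D.O.subtype)) ≤ B →
      (D.w (D.ev (R'.map D.O.subtype))).toNat = m →
      ∃ Q' : D.O[X], (Q'.map D.O.subtype).Monic ∧ (Q'.map D.O.subtype).natDegree = N ∧
      ¬ (e : ℤ) ∣ D.w (D.ev (Q'.map D.O.subtype)) from h _ R0 hR0 hR0N hR0B rfl
  intro m
  induction m using Nat.strong_induction_on with
  | _ m ih =>
  intro R' hR hN hB hm
  by_cases hd : (e : ℤ) ∣ D.w (D.ev (R'.map D.O.subtype))
  swap
  · exact ⟨R', hR, hN, hd⟩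
  obtain ⟨hM, a0, ha0, ha00, hwa0, r0, q0, haa0, hr0, hLq0⟩ := hG _ hR hN hB hd
  have hRO := D.O_nonneg R' (ev_ne_monic (S.N_lt he) hR hN)
  have hR'mon : R'.Monic := (hinj.monic_map_iff).mpr hR
  rw [← ev_def] at hRO
  set R := R'.map D.O.subtype with hRdef
  have hevR := ev_ne_monic (S.N_lt he) hR hN
  have hN0 := S.N_pos
  set δ := D.w (D.ev R) with hδ
  obtain ⟨c, hc, hLc⟩ := res hevR (ev_ne S.N_le ha0 ha00) hwa0.symm
  -- rescale
  obtain ⟨a, r, q, ha, hLa, hLRa, haa, hr, hLq⟩ : ∃ a r q : F[X], a.degree < (N : ℕ) ∧ D.L a δ ∧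
      D.L (R - a) (δ - 1) ∧ a * a = r + R * q ∧ r.degree < (N : ℕ) ∧ D.L q (δ - 1) := by
    refine ⟨C (D.κ c) * a0, C (D.κ c) * (C (D.κ c) * r0), C (D.κ c) * (C (D.κ c) * q0),
      deg_Cmul_lt _ ha0, ?_, hLc, ?_, deg_Cmul_lt _ (deg_Cmul_lt _ hr0), ?_⟩
    · exact ((L_κ c).mul (Or.inr hwa0.le : D.L a0 _)).mono (by simp)
    · linear_combination (C (D.κ c)) ^ 2 * haa0
    · exact ((L_κ c).mul ((L_κ c).mul hLq0)).mono (by simp)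
  have hq : q.degree < (N : ℕ) := by
    have := quot_deg (i := 1) hR hN hr (by
      rw [← haa, show (1 + 1) * N = N + N by ring]; exact deg_mul_lt ha ha)
    simpa using this
  obtain ⟨hRam, hRaN⟩ := deg_sub_monic hR hN ha
  have hwRa := hLRa.resolve_left (ev_ne_monic (S.N_lt he) hRam hRaN)
  obtain ⟨a1, ha1, hLa1, hle1, hnd1⟩ := refine' S he hRam hRaN
  obtain ⟨hRsm, hRsN⟩ := deg_sub_monic hRam hRaN ha1
  set Rs := R - a - a1 with hRs
  set δs := D.w (D.ev Rs) with hδs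
  have hLa1' : D.L a1 (δ - 1) := hLa1.mono hwRa
  have hP := claim e N S Rs δs hRsm hRsN (Or.inr le_rfl) (Or.inr ⟨rfl, hnd1⟩)
  have hAd : (D.P - Rs ^ e).degree < (e * N : ℕ) :=
    deg_monic_sub D.P_monic (hRsm.pow e) (by rw [D.P_deg, S.heN])
      (by rw [hRsm.natDegree_pow, hRsN])
  have hA := (hP.sub (Fil.powR hN0 e)).change hRsm hRsN zero_le_one
    (by omega : δs + 1 ≤ δ) e hAd
  have hRF : D.Fil R N δ δ R := by simpa using Fil.powR (D := D) (R := R) (δ := δ) hN0 1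
  have hRaF : D.Fil R N δ δ (R - a) := hRF.sub (Fil.base ha hLa)
  have hRsF : D.Fil R N δ δ Rs := hRaF.sub (Fil.base ha1 (hLa1'.mono (by omega)))
  have hA2 := Fil.transfer hM (fun a u h1 h2 => Fil.base h1 h2) hRsF hA
  have hA3 := Fil.pow_diff hM hN0 hRaF (Fil.base ha1 hLa1') e
  obtain ⟨i, rfl⟩ : ∃ i, e = i + 1 := ⟨e - 1, by omega⟩
  obtain ⟨X1, Y1, hXY, hX1, hY1⟩ := pow_expand hM hR hN hN0 ha hLa haa hr hq hLq i
  obtain ⟨X2, Z, hY, hX2, hZ⟩ := ((hA2.add hA3).add hY1).split hR hN i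
  have hPeq : (X1 + X2) + R ^ i * (R - ((i + 1 : ℕ) : F[X]) * a + Z) = D.P := by
    linear_combination -hY - hXY
  have hRi := hR.pow i
  have hRiN : (R ^ i).natDegree = i * N := by rw [hR.natDegree_pow, hN]
  obtain ⟨hT, -⟩ := div_modByMonic_unique (f := D.P) (g := R ^ i) _ _ hRi
    ⟨hPeq, by rw [deg_eq hRi hRiN]; exact deg_add_lt hX1 hX2⟩
  set T := D.P /ₘ R ^ i with hTdef
  obtain ⟨P', hP'⟩ := D.P_O
  have hTO : (P' /ₘ R' ^ i).map D.O.subtype = T := by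
    rw [map_divByMonic _ (hR'mon.pow i), hP', Polynomial.map_pow]
  have hle : (R ^ i).degree ≤ D.P.degree := by
    rw [deg_eq hRi hRiN, deg_eq D.P_monic D.P_deg, ← S.heN]
    exact_mod_cast (by nlinarith : i * N ≤ (i + 1) * N)
  have hTm : T.Monic := by
    have := leadingCoeff_divByMonic_of_monic hRi hle
    rw [D.P_monic.leadingCoeff] at this
    exact this
  have hTN : T.natDegree = N := by
    rw [hTdef, natDegree_divByMonic _ hRi, D.P_deg, hRiN, ← S.heN]
    rw [add_mul, one_mul]; omega
  have hc0 : ((i + 1 : ℕ) : K) ≠ 0 := by exact_mod_cast Nat.succ_ne_zero i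
  set c1 : K := ((i + 1 : ℕ) : K)⁻¹ with hc1
  have hdTR := deg_monic_sub hTm hR hTN hN
  obtain ⟨hnm, hnN⟩ := deg_sub_monic hR hN (deg_Cmul_lt (-D.κ c1) hdTR)
  have hmap : (R' + C (⟨D.κ c1, D.κO c1⟩ : D.O) * (P' /ₘ R' ^ i - R')).map D.O.subtype
      = R - C (-D.κ c1) * (T - R) := by
    rw [Polynomial.map_add, Polynomial.map_mul, Polynomial.map_sub, hTO, Polynomial.map_C]
    simp [← hRdef]
  have hform : R - C (-D.κ c1) * (T - R) = (R - a) + C (D.κ c1) * Z := by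
    have h1 : (C (D.κ c1) : F[X]) * ((i + 1 : ℕ) : F[X]) = 1 := by
      rw [show ((i + 1 : ℕ) : F[X]) = C (D.κ ((i + 1 : ℕ) : K)) by simp, ← C_mul, ← map_mul,
        hc1, inv_mul_cancel₀ hc0]
      simp
    rw [hT, C_neg]
    linear_combination (-a) * h1
  have hLn : D.L (R - C (-D.κ c1) * (T - R)) (δ - 1) := by
    rw [hform]
    refine hLRa.add ?_
    have hLZ : D.L Z (δ - 1) := (hZ.toL (Or.inr le_rfl)).mono (by push_cast; linarith)
    exact ((L_κ c1).mul hLZ).mono (by simp)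
  have hwn := hLn.resolve_left (ev_ne_monic (S.N_lt he) hnm hnN)
  refine ih _ ?_ (R' + C (⟨D.κ c1, D.κO c1⟩ : D.O) * (P' /ₘ R' ^ i - R')) ?_ ?_ ?_ rfl
  · have h0 := D.O_nonneg (R' + C (⟨D.κ c1, D.κO c1⟩ : D.O) * (P' /ₘ R' ^ i - R'))
      (by rw [hmap]; exact ev_ne_monic (S.N_lt he) hnm hnN)
    rw [← ev_def] at h0
    rw [hmap] at h0 ⊢
    omega
  · rw [hmap]; exact hnm
  · rw [hmap]; exact hnN
  · rw [hmap]; omega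

/-- all degrees are attained integrally -/
theorem attained [CharZero K] (e : ℕ) : ∀ N, D.Stage e N → D.Good e N → ∀ v : ℕ,
    ∃ H : D.O[X], (H.map D.O.subtype).degree < (N : ℕ) ∧ D.ev (H.map D.O.subtype) ≠ 0 ∧
      D.w (D.ev (H.map D.O.subtype)) = e * v := by
  induction e using Nat.strong_induction_on with
  | _ e ih =>
  intro N S G v
  by_cases he1 : e = 1
  · subst he1
    have hNn : N = D.n := by have := S.heN; omega
    obtain ⟨H, h1, h2, h3⟩ := D.full v
    exact ⟨H, by rw [hNn]; exact h1, h2, by rw [ev_def, h3]; simp⟩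
  have he : 1 < e := by have := S.he; omega
  obtain ⟨Q', hQ, hQN, hnd⟩ := star S G he
  have hinj : Function.Injective D.O.subtype := Subtype.val_injective
  have hQ'mon : Q'.Monic := (hinj.monic_map_iff).mpr hQ
  obtain ⟨k, e', Hk⟩ := key_exists S hQ hQN (ev_ne_monic (S.N_lt he) hQ hQN) hnd
  obtain ⟨H, h1, h2, h3⟩ := ih e' Hk.e'_lt _ Hk.stage (good_step Hk) (k * v)
  refine ⟨H %ₘ Q', ?_⟩
  rw [map_modByMonic _ hQ'mon]
  set Q := Q'.map D.O.subtype with hQdef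
  set A := H.map D.O.subtype with hA
  have hdm := modByMonic_add_div A Q
  have had : (A %ₘ Q).degree < (N : ℕ) := by
    rw [← deg_eq hQ hQN]; exact degree_modByMonic_lt A hQ
  set a := A %ₘ Q with hadef
  set B := A /ₘ Q with hB
  have hwA : D.w (D.ev A) = e * v := by
    rw [h3, Hk.hk]; push_cast; ring
  refine ⟨had, ?_⟩
  by_cases hB0 : B = 0
  · rw [hB0, mul_zero, add_zero] at hdm
    rw [hdm]; exact ⟨h2, hwA⟩
  have hk1 : 1 ≤ k := by have := Hk.k_two; omega
  obtain ⟨k', rfl⟩ : ∃ k', k = k' + 1 := ⟨k - 1, by omega⟩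
  have hBd : B.degree < (k' * N : ℕ) := quot_deg hQ hQN had (by rw [hdm]; exact h1)
  obtain ⟨hB1, -, l, hl, hl2⟩ := Hk.decomp k' (by omega) B hBd hB0
  set δ := D.w (D.ev Q) with hδ
  have hQB0 : D.ev (Q * B) ≠ 0 := by rw [map_mul]; exact mul_ne_zero Hk.ev0 hB1
  have hnQB : ¬ (e : ℤ) ∣ D.w (D.ev (Q * B)) := by
    intro hcon
    rw [map_mul, D.w_mul _ _ Hk.ev0 hB1, ← hδ] at hcon
    have : (e : ℤ) ∣ ((l + 1 : ℕ) : ℤ) * δ := by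
      have h5 := dvd_sub hcon hl2
      have e1 : δ + D.w (D.ev B) - (D.w (D.ev B) - l * δ) = ((l + 1 : ℕ) : ℤ) * δ := by
        push_cast; ring
      rwa [e1] at h5
    have := Nat.le_of_dvd (by omega) (Hk.h1 _ this)
    omega
  have heA : D.ev A = D.ev a + D.ev (Q * B) := by rw [← map_add, hdm]
  by_cases ha0 : a = 0
  · rw [ha0, map_zero, zero_add] at heA
    rw [← heA, hwA] at hnQB
    exact absurd (dvd_mul_right _ _) hnQB
  have hea := ev_ne S.N_le had ha0
  have hda := S.S1 a had ha0
  obtain ⟨h5, h6⟩ := w_add_ne hea hQB0 (fun h => hnQB (h ▸ hda))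
  refine ⟨hea, ?_⟩
  rw [← heA, hwA] at h6
  rcases max_choice (D.w (D.ev a)) (D.w (D.ev (Q * B))) with h | h
  · rw [h6, h]
  · rw [h] at h6; rw [← h6] at hnQB
    exact absurd (dvd_mul_right _ _) hnQB

theorem conclusion [CharZero K] (hn : 1 < D.n) :
    ∃ c : D.O, D.g - D.j c ≠ 0 ∧ 0 < D.w (D.g - D.j c) ∧ D.w (D.g - D.j c) < D.n := by
  obtain ⟨Q', hQ, hQN, hnd⟩ := star stage_base good_base hn
  have hinj : Function.Injective D.O.subtype := Subtype.val_injective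
  have hQ'mon : Q'.Monic := (hinj.monic_map_iff).mpr hQ
  have hQ'N : Q'.natDegree = 1 := by rw [← hQN, natDegree_map_eq_of_injective hinj]
  have hev0 := ev_ne_monic hn hQ hQN
  obtain ⟨k, e', Hk⟩ := key_exists stage_base hQ hQN hev0 hnd
  obtain ⟨H, h1, h2, h3⟩ := attained e' _ Hk.stage (good_step Hk) 1
  have hQO := D.O_nonneg Q' hev0
  rw [← ev_def] at hQO
  have hBO := D.O_nonneg (H /ₘ Q')
  rw [map_divByMonic _ hQ'mon, ← ev_def] at hBO
  have hform : Q' = X + C (Q'.coeff 0) := by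
    conv_lhs => rw [hQ'mon.as_sum, hQ'N]
    simp
  set Q := Q'.map D.O.subtype with hQdef
  set A := H.map D.O.subtype with hA
  have hdm := modByMonic_add_div A Q
  have had : (A %ₘ Q).degree < ((1 : ℕ) : WithBot ℕ) := by
    rw [← deg_eq hQ hQN]; exact degree_modByMonic_lt A hQ
  set a := A %ₘ Q with hadef
  set B := A /ₘ Q with hB
  set δ := D.w (D.ev Q) with hδ
  have he' := Hk.e'_pos
  have hlt := Hk.e'_lt
  have hnd' : ¬ (D.n : ℤ) ∣ D.w (D.ev A) := by
    rw [h3]; simp only [Nat.cast_one, mul_one]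
    intro h
    have h' : D.n ∣ e' := by exact_mod_cast h
    have := Nat.le_of_dvd he' h'
    omega
  have heA : D.ev A = D.ev a + D.ev (Q * B) := by rw [← map_add, hdm]
  have hB0 : B ≠ 0 := by
    intro h
    rw [h, mul_zero, map_zero, add_zero] at heA
    rw [heA] at hnd' h2
    exact hnd' (stage_base.S1 a had (by rintro h; rw [h, map_zero] at h2; exact h2 rfl))
  obtain ⟨k', rfl⟩ : ∃ k', k = k' + 1 := ⟨k - 1, by have := Hk.k_two; omega⟩
  have hBd : B.degree < (k' * 1 : ℕ) := quot_deg hQ hQN had (by rw [hdm]; exact h1)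
  obtain ⟨hB1, -, l, hl, hl2⟩ := Hk.decomp k' (by omega) B hBd hB0
  have hB2 := hBO hB1
  have hQB0 : D.ev (Q * B) ≠ 0 := by rw [map_mul]; exact mul_ne_zero Hk.ev0 hB1
  have hwQB : D.w (D.ev (Q * B)) = δ + D.w (D.ev B) := by
    rw [map_mul, D.w_mul _ _ Hk.ev0 hB1]
  have hle : δ + D.w (D.ev B) ≤ e' := by
    rw [← hwQB]
    by_cases ha0 : a = 0
    · rw [ha0, map_zero, zero_add] at heA
      rw [← heA, h3]; simp
    have hea := ev_ne (stage_base (D := D)).N_le had ha0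
    have hda := (stage_base (D := D)).S1 a had ha0
    have hne : D.w (D.ev a) ≠ D.w (D.ev (Q * B)) := by
      intro h
      rw [h, hwQB] at hda
      have : (D.n : ℤ) ∣ ((l + 1 : ℕ) : ℤ) * δ := by
        have h5 := dvd_sub hda hl2
        have e1 : δ + D.w (D.ev B) - (D.w (D.ev B) - l * δ) = ((l + 1 : ℕ) : ℤ) * δ := by
          push_cast; ring
        rwa [e1] at h5
      have := Nat.le_of_dvd (by omega) (Hk.h1 _ this)
      omega
    obtain ⟨-, h6⟩ := w_add_ne hea hQB0 hne
    rw [← heA, h3] at h6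
    have := le_max_right (D.w (D.ev a)) (D.w (D.ev (Q * B)))
    rw [← h6] at this
    simpa using this
  have hpos : 0 < δ := by
    rcases hQO.lt_or_eq with h | h
    · exact h
    · exact absurd (h ▸ dvd_zero _) hnd
  have hQev : D.ev Q = D.g - D.j (-(Q'.coeff 0) : D.O) := by
    rw [hQdef, hform]
    simp [ev]
  refine ⟨-(Q'.coeff 0), ?_, ?_, ?_⟩
  · rw [← hQev]; exact hev0
  · rw [← hQev]; exact hpos
  · rw [← hQev]; omega

end AMSData

namespace AMSConc

theorem span_of_indep {F : Type*} [Field F] {n : ℕ} (T : Fin n → F[X])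
    (hT : ∀ i, (T i).degree < (n : ℕ)) (hind : ∀ r : Fin n → F, ∑ i, C (r i) * T i = 0 → r = 0)
    (u : F[X]) (hu : u.degree < (n : ℕ)) : ∃ r : Fin n → F, u = ∑ i, C (r i) * T i := by
  let ψ : (Fin n → F) →ₗ[F] (Fin n → F) :=
    Fintype.linearCombination F (fun i (k : Fin n) => (T i).coeff k)
  have hψ : ∀ r k, ψ r k = ∑ i, r i * (T i).coeff k := by
    intro r k
    simp [ψ, Fintype.linearCombination_apply, Finset.sum_apply]
  have hcoe : ∀ (r : Fin n → F) (k : ℕ), (∑ i, C (r i) * T i).coeff k = ∑ i, r i * (T i).coeff k := by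
    intro r k
    simp [finsetSum_coeff]
  have hbig : ∀ (r : Fin n → F) (k : ℕ), n ≤ k → (∑ i, C (r i) * T i).coeff k = 0 := by
    intro r k hk
    rw [hcoe]
    refine Finset.sum_eq_zero fun i _ => ?_
    rw [coeff_eq_zero_of_degree_lt ((hT i).trans_le (by exact_mod_cast hk)), mul_zero]
  have hinj : Function.Injective ψ := by
    rw [← LinearMap.ker_eq_bot, LinearMap.ker_eq_bot']
    intro r hr
    apply hind
    ext k
    rw [coeff_zero]
    by_cases hk : k < n
    · rw [hcoe, ← hψ r ⟨k, hk⟩, hr]; rfl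
    · exact hbig r k (by omega)
  obtain ⟨r, hr⟩ := (LinearMap.injective_iff_surjective.mp hinj) (fun k => u.coeff k)
  refine ⟨r, ?_⟩
  ext k
  by_cases hk : k < n
  · rw [hcoe, ← hψ r ⟨k, hk⟩, hr]
  · rw [hbig r k (by omega), coeff_eq_zero_of_degree_lt (hu.trans_le (by exact_mod_cast not_lt.mp hk))]

section
variable {K : Type*} [Field K]

local notation "ι" => algebraMap K[X] (RatFunc K)

theorem rep (f : K[X]) {n : ℕ} (hn : f.natDegree = n) (hn0 : 0 < n) (h : K[X]) :
    ∃ r : Fin n → K[X], h = ∑ i : Fin n, (r i).comp f * X ^ (i : ℕ) := by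
  have hfd : 0 < f.degree := natDegree_pos_iff_degree_pos.mp (by omega)
  have hf0 : f ≠ 0 := by rintro rfl; simp at hfd
  generalize hd : h.degree = d
  induction d using WellFoundedLT.induction generalizing h with
  | _ d ih =>
    by_cases h0 : h = 0
    · exact ⟨0, by simp [h0]⟩
    obtain ⟨r, hr⟩ := ih _ (hd ▸ degree_div_lt h0 hfd) (h / f) rfl
    refine ⟨fun i => C ((h % f).coeff i) + X * r i, ?_⟩
    have h1 := EuclideanDomain.div_add_mod h f
    have h2 : (h % f) = ∑ i : Fin n, C ((h % f).coeff i) * X ^ (i : ℕ) := by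
      have : (h % f).degree < (n : ℕ) := by
        have := degree_mod_lt h hf0
        rwa [degree_eq_natDegree hf0, hn] at this
      have h3 := (h % f).as_sum_range_C_mul_X_pow' (n := n) (by
        by_cases h4 : h % f = 0
        · rw [h4]; simpa using hn0
        · exact (natDegree_lt_iff_degree_lt h4).mpr this)
      rw [Finset.sum_range] at h3
      exact h3
    calc h = f * (h / f) + h % f := h1.symm
      _ = f * (∑ i : Fin n, (r i).comp f * X ^ (i : ℕ)) +
          ∑ i : Fin n, C ((h % f).coeff i) * X ^ (i : ℕ) := by rw [← hr, ← h2]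
      _ = _ := by
        rw [Finset.mul_sum, ← Finset.sum_add_distrib]
        refine Finset.sum_congr rfl fun i _ => ?_
        simp; ring

theorem exists_P (f g : K[X]) {n : ℕ} (hn : f.natDegree = n) (hn0 : 0 < n) :
    ∃ P : K[X][X], P.Monic ∧ P.natDegree = n ∧ P.eval₂ (compRingHom f) g = 0 := by
  choose M hM using fun i : Fin n => rep f hn hn0 (g * X ^ (i : ℕ))
  refine ⟨Matrix.charpoly (Matrix.of M), Matrix.charpoly_monic _, by simp, ?_⟩
  rw [← coe_eval₂RingHom, Matrix.charpoly, RingHom.map_det, ← Matrix.exists_mulVec_eq_zero_iff]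
  refine ⟨fun i => X ^ (i : ℕ), ?_, ?_⟩
  · intro h
    have := congrFun h ⟨0, hn0⟩
    simp at this
  · ext1 i
    have hent : ∀ j, (eval₂RingHom (compRingHom f) g) (Matrix.charmatrix (Matrix.of M) i j) =
        (if i = j then g else 0) - (M i j).comp f := by
      intro j
      rw [Matrix.charmatrix_apply, Matrix.diagonal_apply, map_sub]
      split_ifs <;> simp
    simp only [Matrix.mulVec, dotProduct, RingHom.mapMatrix_apply, Matrix.map_apply, hent,
      Pi.zero_apply, sub_mul, Finset.sum_sub_distrib]
    rw [← hM i, sub_eq_zero, Finset.sum_eq_single i]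
    · simp
    · intro j _ hj
      rw [if_neg (Ne.symm hj), zero_mul]
    · simp

theorem intDegree_add_ne {a b : RatFunc K} (ha : a ≠ 0) (hb : b ≠ 0)
    (h : a.intDegree ≠ b.intDegree) :
    a + b ≠ 0 ∧ (a + b).intDegree = max a.intDegree b.intDegree := by
  have h0 : a + b ≠ 0 := by
    intro h0
    have : a = -b := eq_neg_of_add_eq_zero_left h0
    rw [this, RatFunc.intDegree_neg] at h
    exact h rfl
  refine ⟨h0, ?_⟩
  have h1 := RatFunc.intDegree_add_le hb h0
  have h2 := RatFunc.intDegree_add_le (x := a + b) (y := -b) (by simpa using hb) (by simpa using ha)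
  have h3 := RatFunc.intDegree_add_le (x := a + b) (y := -a) (by simpa using ha) (by simpa using hb)
  rw [RatFunc.intDegree_neg] at h2 h3
  simp only [add_neg_cancel_right] at h2
  have e : a + b + -a = b := by ring
  rw [e] at h3
  grind

theorem intDegree_sum_exists {I : Type*} [DecidableEq I] (s : Finset I) (x : I → RatFunc K)
    (h : ∑ i ∈ s, x i ≠ 0) :
    ∃ i ∈ s, x i ≠ 0 ∧ (∑ i ∈ s, x i).intDegree ≤ (x i).intDegree := by
  induction s using Finset.induction_on with
  | empty => simp at h
  | insert a s ha ih =>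
    rw [Finset.sum_insert ha] at h ⊢
    by_cases hs : ∑ i ∈ s, x i = 0
    · rw [hs, add_zero] at h ⊢
      exact ⟨a, Finset.mem_insert_self _ _, h, le_rfl⟩
    obtain ⟨i, hi, hi0, hle⟩ := ih hs
    by_cases hxa : x a = 0
    · rw [hxa, zero_add]
      exact ⟨i, Finset.mem_insert_of_mem hi, hi0, hle⟩
    have h1 := RatFunc.intDegree_add_le hs h
    rcases le_max_iff.mp h1 with h2 | h2
    · exact ⟨a, Finset.mem_insert_self _ _, hxa, h2⟩
    · exact ⟨i, Finset.mem_insert_of_mem hi, hi0, h2.trans hle⟩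

theorem intDegree_sum_distinct {I : Type*} [DecidableEq I] (s : Finset I) (x : I → RatFunc K)
    (hd : ∀ i ∈ s, ∀ k ∈ s, x i ≠ 0 → x k ≠ 0 → (x i).intDegree = (x k).intDegree → i = k) :
    ∀ i ∈ s, x i ≠ 0 → ∑ i ∈ s, x i ≠ 0 ∧ (x i).intDegree ≤ (∑ i ∈ s, x i).intDegree := by
  induction s using Finset.induction_on with
  | empty => simp
  | insert a s ha ih =>
    have ih := ih (fun i hi k hk => hd i (Finset.mem_insert_of_mem hi) k (Finset.mem_insert_of_mem hk))
    rw [Finset.sum_insert ha]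
    by_cases hxa : x a = 0
    · rw [hxa, zero_add]
      intro i hi hi0
      rcases Finset.mem_insert.mp hi with rfl | hi
      · exact absurd hxa hi0
      · exact ih i hi hi0
    by_cases hs : ∑ i ∈ s, x i = 0
    · rw [hs, add_zero]
      intro i hi hi0
      rcases Finset.mem_insert.mp hi with rfl | hi
      · exact ⟨hi0, le_rfl⟩
      · exact absurd hs (ih i hi hi0).1
    obtain ⟨k, hk, hk0, hle⟩ := intDegree_sum_exists s x hs
    have hk2 := (ih k hk hk0).2
    have heq : (∑ i ∈ s, x i).intDegree = (x k).intDegree := le_antisymm hle hk2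
    obtain ⟨h1, h2⟩ := intDegree_add_ne hxa hs (by
      rw [heq]
      intro h
      have := hd a (Finset.mem_insert_self _ _) k (Finset.mem_insert_of_mem hk) hxa hk0 h
      exact ha (this ▸ hk))
    intro i hi hi0
    refine ⟨h1, ?_⟩
    rw [h2]
    rcases Finset.mem_insert.mp hi with rfl | hi
    · exact le_max_left _ _
    · exact (ih i hi hi0).2.trans (le_max_right _ _)

theorem common (a b : RatFunc K) : ∃ p q s : K[X], s ≠ 0 ∧ a * ι s = ι p ∧ b * ι s = ι q := by
  have ha := RatFunc.num_div_denom a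
  have hb := RatFunc.num_div_denom b
  have ha0 : ι a.denom ≠ 0 := by simpa using RatFunc.denom_ne_zero a
  have hb0 : ι b.denom ≠ 0 := by simpa using RatFunc.denom_ne_zero b
  rw [div_eq_iff ha0] at ha
  rw [div_eq_iff hb0] at hb
  refine ⟨a.num * b.denom, b.num * a.denom, a.denom * b.denom,
    mul_ne_zero (RatFunc.denom_ne_zero a) (RatFunc.denom_ne_zero b), ?_, ?_⟩
  · rw [map_mul, map_mul]
    linear_combination -(ι b.denom) * ha
  · rw [map_mul, map_mul]
    linear_combination -(ι a.denom) * hb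

theorem residue (a b : RatFunc K) (ha : a ≠ 0) (hb : b ≠ 0) (h : a.intDegree = b.intDegree) :
    ∃ c : K, c ≠ 0 ∧ (a - ι (C c) * b = 0 ∨ (a - ι (C c) * b).intDegree < a.intDegree) := by
  obtain ⟨p, q, s, hs, hp, hq⟩ := common a b
  have hs' : ι s ≠ 0 := by simpa using hs
  have hp0 : p ≠ 0 := by
    rintro rfl; rw [map_zero] at hp; exact (mul_ne_zero ha hs') hp
  have hq0 : q ≠ 0 := by
    rintro rfl; rw [map_zero] at hq; exact (mul_ne_zero hb hs') hq
  have h1 := RatFunc.intDegree_mul ha hs'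
  have h2 := RatFunc.intDegree_mul hb hs'
  rw [hp, RatFunc.intDegree_polynomial, RatFunc.intDegree_polynomial] at h1
  rw [hq, RatFunc.intDegree_polynomial, RatFunc.intDegree_polynomial] at h2
  have hc : p.leadingCoeff / q.leadingCoeff ≠ 0 :=
    div_ne_zero (leadingCoeff_ne_zero.mpr hp0) (leadingCoeff_ne_zero.mpr hq0)
  set c := p.leadingCoeff / q.leadingCoeff with hcdef
  refine ⟨c, hc, ?_⟩
  rw [or_iff_not_imp_left]
  intro h0
  have hnd : p.natDegree = q.natDegree := by omega
  have h3 : (a - ι (C c) * b) * ι s = ι (p - C c * q) := by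
    rw [map_sub, map_mul, ← hp, ← hq]; ring
  have h4 := RatFunc.intDegree_mul h0 hs'
  rw [h3, RatFunc.intDegree_polynomial, RatFunc.intDegree_polynomial] at h4
  have h5 : p - C c * q ≠ 0 := by
    intro h5
    rw [h5, map_zero] at h3
    exact mul_ne_zero h0 hs' h3
  have h6 : (p - C c * q).degree < p.degree := by
    apply degree_sub_lt_left _ hp0
    · rw [leadingCoeff_mul, leadingCoeff_C, hcdef, div_mul_cancel₀ _ (leadingCoeff_ne_zero.mpr hq0)]
    · rw [degree_mul, degree_C hc, zero_add, degree_eq_natDegree hp0, degree_eq_natDegree hq0, hnd]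
  have h7 := natDegree_lt_natDegree h5 h6
  omega

theorem comp_inj {f : K[X]} (hf : 0 < f.natDegree) :
    Function.Injective ((ι).comp (compRingHom f)) := by
  rw [RingHom.coe_comp]
  refine (FaithfulSMul.algebraMap_injective K[X] (RatFunc K)).comp ?_
  rw [injective_iff_map_eq_zero]
  intro p hp
  rw [coe_compRingHom] at hp
  rcases comp_eq_zero_iff.mp hp with h | ⟨-, h⟩
  · exact h
  · rw [h, natDegree_C] at hf; omega

/-- substitution of `f` -/
noncomputable def jmap (f : K[X]) (hf : 0 < f.natDegree) : RatFunc K →+* RatFunc K :=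
  IsFractionRing.lift (comp_inj hf)

theorem jmap_alg (f : K[X]) (hf : 0 < f.natDegree) (p : K[X]) : jmap f hf (ι p) = ι (p.comp f) := by
  rw [jmap, IsFractionRing.lift_algebraMap]; simp

theorem w_jmap (f : K[X]) (hf : 0 < f.natDegree) (r : RatFunc K) (hr : r ≠ 0) :
    (jmap f hf r).intDegree = f.natDegree * r.intDegree := by
  obtain ⟨p, -, s, hs, hp, -⟩ := common r r
  have hs' : ι s ≠ 0 := by simpa using hs
  have hjs : jmap f hf (ι s) ≠ 0 := by simpa using hs
  have hjr : jmap f hf r ≠ 0 := by simpa using hr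
  have h1 := RatFunc.intDegree_mul hr hs'
  have h2 := RatFunc.intDegree_mul hjr hjs
  rw [← map_mul, hp, jmap_alg, jmap_alg, RatFunc.intDegree_polynomial,
    RatFunc.intDegree_polynomial, natDegree_comp, natDegree_comp] at h2
  rw [hp, RatFunc.intDegree_polynomial, RatFunc.intDegree_polynomial] at h1
  push_cast at h2
  rw [h1] at h2
  linarith

theorem ev_map (f g : K[X]) (hf : 0 < f.natDegree) (H : K[X][X]) :
    (H.map ι).eval₂ (jmap f hf) (ι g) = ι (H.eval₂ (compRingHom f) g) := by
  rw [eval₂_map, hom_eval₂]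
  have : (jmap f hf).comp ι = (ι).comp (compRingHom f) := by
    refine RingHom.ext fun x => ?_
    rw [RingHom.comp_apply, jmap_alg]; simp
  rw [this]

theorem reduce {f g : K[X]} (P : K[X][X]) (hP : P.Monic) {n : ℕ} (hPn : P.natDegree = n)
    (hP0 : P.eval₂ (compRingHom f) g = 0)
    (hs : ∀ h : K[X], ∃ H : K[X][X], H.eval₂ (compRingHom f) g = h) (h : K[X]) :
    ∃ H : K[X][X], H.degree < (n : ℕ) ∧ H.eval₂ (compRingHom f) g = h := by
  obtain ⟨H, hH⟩ := hs h
  refine ⟨H %ₘ P, ?_, ?_⟩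
  · rw [← hPn, ← degree_eq_natDegree hP.ne_zero]; exact degree_modByMonic_lt H hP
  · rw [← modByMonic_add_div H P, eval₂_add, eval₂_mul, hP0, zero_mul, add_zero] at hH
    exact hH

theorem w_term (f : K[X]) (hf : 0 < f.natDegree) (r : RatFunc K) (hr : r ≠ 0) (i : ℕ) :
    (jmap f hf r * ι (X ^ i)).intDegree = f.natDegree * r.intDegree + i := by
  rw [RatFunc.intDegree_mul (by simpa using hr) (by simp [RatFunc.X_ne_zero]), w_jmap f hf r hr,
    RatFunc.intDegree_polynomial, natDegree_X_pow]

theorem term_ne (f : K[X]) (hf : 0 < f.natDegree) (r : RatFunc K) (i : ℕ) :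
    jmap f hf r * ι (X ^ i) ≠ 0 ↔ r ≠ 0 := by
  simp [RatFunc.X_ne_zero]

theorem sum_term (f : K[X]) (hf : 0 < f.natDegree) (r : Fin f.natDegree → RatFunc K)
    (i : Fin f.natDegree) (hi : r i ≠ 0) :
    ∑ i, jmap f hf (r i) * ι (X ^ (i : ℕ)) ≠ 0 ∧
    f.natDegree * (r i).intDegree + (i : ℕ) ≤
      (∑ i, jmap f hf (r i) * ι (X ^ (i : ℕ))).intDegree := by
  rw [← w_term f hf (r i) hi]
  refine intDegree_sum_distinct Finset.univ (fun i => jmap f hf (r i) * ι (X ^ (i : ℕ))) ?_ i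
    (Finset.mem_univ i) ((term_ne f hf _ _).mpr hi)
  intro a _ b _ ha hb hab
  have ha := (term_ne f hf _ _).mp ha
  have hb := (term_ne f hf _ _).mp hb
  simp only [w_term f hf _ ha, w_term f hf _ hb] at hab
  have h1 := a.2
  have h2 := b.2
  have h3 : ((a : ℕ) : ℤ) % f.natDegree = ((b : ℕ) : ℤ) % f.natDegree := by
    have := congrArg (· % (f.natDegree : ℤ)) hab
    simpa [Int.add_emod] using this
  rw [Int.emod_eq_of_lt (by omega) (by omega), Int.emod_eq_of_lt (by omega) (by omega)] at h3
  exact Fin.ext (by omega)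

theorem exists_data (f g : K[X]) (hf : 0 < f.natDegree)
    (hs : ∀ h : K[X], ∃ H : K[X][X], H.eval₂ (compRingHom f) g = h) :
    ∃ D : AMSData K (RatFunc K) (RatFunc K), D.w = RatFunc.intDegree ∧ D.j = jmap f hf ∧
      D.g = ι g ∧ D.n = f.natDegree ∧ D.O = (ι).range := by
  obtain ⟨P, hP, hPn, hP0⟩ := exists_P f g rfl hf
  have hιinj : Function.Injective ι := FaithfulSMul.algebraMap_injective K[X] (RatFunc K)
  choose T0 hT0d hT0e using fun i : Fin f.natDegree =>
    reduce P hP hPn hP0 hs (X ^ (i : ℕ))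
  have hTd : ∀ i, ((T0 i).map ι).degree < (f.natDegree : ℕ) := fun i =>
    degree_map_le.trans_lt (hT0d i)
  have hsumev : ∀ r : Fin f.natDegree → RatFunc K,
      (∑ i, C (r i) * (T0 i).map ι).eval₂ (jmap f hf) (ι g) =
        ∑ i, jmap f hf (r i) * ι (X ^ (i : ℕ)) := by
    intro r
    rw [eval₂_finsetSum]
    refine Finset.sum_congr rfl fun i _ => ?_
    rw [eval₂_mul, eval₂_C, ev_map, hT0e]
  have hspan := span_of_indep (fun i => (T0 i).map ι) hTd (by
    intro r hr
    ext1 i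
    by_contra hi
    apply (sum_term f hf r i hi).1
    rw [← hsumev, hr, eval₂_zero])
  have hinj : ∀ u : (RatFunc K)[X], u ≠ 0 → u.degree < (f.natDegree : ℕ) →
      u.eval₂ (jmap f hf) (ι g) ≠ 0 := by
    intro u hu hd
    obtain ⟨r, rfl⟩ := hspan u hd
    rw [hsumev]
    obtain ⟨i, hi⟩ : ∃ i, r i ≠ 0 := by
      by_contra hcon
      push Not at hcon
      exact hu (by simp [hcon])
    exact (sum_term f hf r i hi).1
  have hOmap : ∀ H : K[X][X], (H.map (ι).rangeRestrict).map (ι).range.subtype = H.map ι := by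
    intro H
    rw [Polynomial.map_map]; rfl
  refine ⟨{
    w := RatFunc.intDegree
    κ := (ι).comp C
    j := jmap f hf
    g := ι g
    n := f.natDegree
    P := P.map ι
    O := (ι).range
    w_mul := fun a b ha hb => RatFunc.intDegree_mul ha hb
    w_add := fun a b _ hb hab => RatFunc.intDegree_add_le hb hab
    w_res := ?_
    w_κ := ?_
    n_pos := hf
    wF := ?_
    wF' := ?_
    P_monic := hP.map _
    P_deg := by rw [hP.natDegree_map, hPn]
    P_ev := by rw [ev_map, hP0, map_zero]
    inj := hinj
    bdd := ?_
    κO := fun c => ⟨C c, rfl⟩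
    P_O := ⟨P.map (ι).rangeRestrict, hOmap P⟩
    O_nonneg := ?_
    full := ?_ }, rfl, rfl, rfl, rfl, rfl⟩
  · intro a b ha hb hab
    obtain ⟨c, hc, h⟩ := residue a b ha hb hab
    refine ⟨c, hc, ?_⟩
    rw [RingHom.comp_apply, jmap_alg, C_comp]
    exact h
  · intro c hc
    rw [RingHom.comp_apply, jmap_alg, C_comp, RatFunc.intDegree_polynomial]; simp
  · intro r hr
    exact ⟨_, w_jmap f hf r hr⟩
  · intro v
    have hX : (RatFunc.X : RatFunc K) ≠ 0 := RatFunc.X_ne_zero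
    have hz : ∀ v : ℤ, (RatFunc.X ^ v : RatFunc K).intDegree = v := by
      have hnat : ∀ m : ℕ, ((RatFunc.X : RatFunc K) ^ m).intDegree = m := by
        intro m
        rw [← RatFunc.algebraMap_X, ← map_pow, RatFunc.intDegree_polynomial, natDegree_X_pow]
      intro v
      obtain ⟨m, rfl | rfl⟩ := v.eq_nat_or_neg
      · rw [zpow_natCast, hnat]
      · rw [zpow_neg, zpow_natCast, RatFunc.intDegree_inv, hnat]
    exact ⟨RatFunc.X ^ v, zpow_ne_zero _ hX, by rw [w_jmap f hf _ (zpow_ne_zero _ hX), hz]⟩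
  · intro N hN
    let τ : Fin f.natDegree → RatFunc K := fun i => ((T0 i).map ι).coeff (f.natDegree - 1)
    refine ⟨-(f.natDegree * ∑ i, |(τ i).intDegree|) -
      ((ι g) ^ (f.natDegree - 1 - N)).intDegree, ?_⟩
    intro R hR hRN
    have hmon : (R * X ^ (f.natDegree - 1 - N)).Monic := hR.mul (monic_X_pow _)
    have hnd : (R * X ^ (f.natDegree - 1 - N)).natDegree = f.natDegree - 1 := by
      rw [hR.natDegree_mul (monic_X_pow _), natDegree_X_pow, hRN]; omega
    have hdeg : (R * X ^ (f.natDegree - 1 - N)).degree < ((f.natDegree : ℕ) : WithBot ℕ) := by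
      rw [degree_eq_natDegree hmon.ne_zero, hnd]
      exact_mod_cast (by omega : f.natDegree - 1 < f.natDegree)
    have hne := hinj _ hmon.ne_zero hdeg
    obtain ⟨r, hr⟩ := hspan _ hdeg
    have hco : (1 : RatFunc K) = ∑ i, r i * τ i := by
      have := hmon.coeff_natDegree
      rw [hnd, hr] at this
      rw [← this]
      simp [finsetSum_coeff, τ]
    obtain ⟨i, -, hi0, hi⟩ := intDegree_sum_exists Finset.univ (fun i => r i * τ i)
      (by rw [← hco]; exact one_ne_zero)
    rw [← hco, RatFunc.intDegree_one,
      RatFunc.intDegree_mul (left_ne_zero_of_mul hi0) (right_ne_zero_of_mul hi0)] at hi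
    have h1 := (sum_term f hf r i (left_ne_zero_of_mul hi0)).2
    rw [← hsumev, ← hr] at h1
    rw [eval₂_mul, eval₂_X_pow] at h1 hne
    rw [RatFunc.intDegree_mul (left_ne_zero_of_mul hne) (right_ne_zero_of_mul hne)] at h1
    have h2 : |(τ i).intDegree| ≤ ∑ i, |(τ i).intDegree| :=
      Finset.single_le_sum (f := fun i => |(τ i).intDegree|) (fun i _ => abs_nonneg _)
        (Finset.mem_univ i)
    have h3 := le_abs_self (τ i).intDegree
    have h4 : (f.natDegree : ℤ) * (-∑ i, |(τ i).intDegree|) ≤ f.natDegree * (r i).intDegree :=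
      mul_le_mul_of_nonneg_left (by omega) (by omega)
    linarith [Int.natCast_nonneg (i : ℕ)]
  · intro H
    obtain ⟨H', rfl⟩ := map_surjective _ (ι).rangeRestrict_surjective H
    rw [hOmap, ev_map]
    intro _
    rw [RatFunc.intDegree_polynomial]; omega
  · intro v
    obtain ⟨H, hH, he⟩ := reduce P hP hPn hP0 hs (X ^ v)
    refine ⟨H.map (ι).rangeRestrict, ?_⟩
    rw [hOmap, ev_map, he]
    refine ⟨degree_map_le.trans_lt hH, by simp [RatFunc.X_ne_zero], by rw [RatFunc.intDegree_polynomial]; simp⟩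

theorem step [CharZero K] (f g : K[X]) (hf : 1 < f.natDegree)
    (hs : ∀ h : K[X], ∃ H : K[X][X], H.eval₂ (compRingHom f) g = h) :
    ∃ c : K[X], 0 < (g - c.comp f).natDegree ∧ (g - c.comp f).natDegree < f.natDegree := by
  obtain ⟨D, hw, hj, hg, hn, hO⟩ := exists_data f g (by omega) hs
  obtain ⟨c, -, h1, h2⟩ := D.conclusion (by rw [hn]; exact hf)
  obtain ⟨c, hc⟩ := c
  simp only at h1 h2
  rw [hO] at hc
  obtain ⟨c0, hc0⟩ := hc
  rw [← hc0, hw, hj, hg, jmap_alg, ← map_sub, RatFunc.intDegree_polynomial] at h1 h2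
  rw [hn] at h2
  exact ⟨c0, by exact_mod_cast h1, by exact_mod_cast h2⟩

end
end AMSConc

end AMSSection

namespace AMSFin
section
variable {K : Type*} [Field K]

/-- elementary map -/
noncomputable def elemHom (c : Polynomial K) :
    MvPolynomial (Fin 2) K →ₐ[K] MvPolynomial (Fin 2) K :=
  MvPolynomial.aeval ![MvPolynomial.X 0,
    MvPolynomial.X 1 - Polynomial.aeval (MvPolynomial.X 0 : MvPolynomial (Fin 2) K) c]

theorem elemHom_comp (c d : Polynomial K) (h : c + d = 0) :
    (elemHom c).comp (elemHom d) = AlgHom.id K _ := by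
  apply MvPolynomial.algHom_ext
  intro i
  fin_cases i
  · simp [elemHom]
  · have hd : d = -c := by rw [eq_neg_iff_add_eq_zero, add_comm]; exact h
    subst hd
    simp [elemHom, ← Polynomial.aeval_algHom_apply]

/-- elementary automorphism -/
noncomputable def elem (c : Polynomial K) : MvPolynomial (Fin 2) K ≃ₐ[K] MvPolynomial (Fin 2) K :=
  AlgEquiv.ofAlgHom (elemHom c) (elemHom (-c)) (elemHom_comp _ _ (by simp))
    (elemHom_comp _ _ (by simp))

/-- the parametrization -/
noncomputable def pm (f g : Polynomial K) : MvPolynomial (Fin 2) K →ₐ[K] Polynomial K :=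
  MvPolynomial.aeval ![f, g]

theorem pm_elem (f g c : Polynomial K) (q : MvPolynomial (Fin 2) K) :
    pm f g (elem c q) = pm f (g - c.comp f) q := by
  have : (pm f g).comp (elemHom c) = pm f (g - c.comp f) := by
    apply MvPolynomial.algHom_ext
    intro i
    fin_cases i
    · simp [elemHom, pm]
    · simp [elemHom, pm, ← Polynomial.aeval_algHom_apply, Polynomial.comp_eq_aeval]
  exact DFunLike.congr_fun this q

/-- swap -/
noncomputable def sw : MvPolynomial (Fin 2) K ≃ₐ[K] MvPolynomial (Fin 2) K :=
  MvPolynomial.renameEquiv K (Equiv.swap 0 1)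

theorem pm_sw (f g : Polynomial K) (q : MvPolynomial (Fin 2) K) :
    pm f g (sw q) = pm g f q := by
  have : (pm f g).comp (sw : MvPolynomial (Fin 2) K ≃ₐ[K] MvPolynomial (Fin 2) K).toAlgHom
      = pm g f := by
    apply MvPolynomial.algHom_ext
    intro i
    fin_cases i
    · simp [sw, pm]
    · simp [sw, pm]
  exact DFunLike.congr_fun this q

/-- rectifiable pairs -/
def Rect (f g : Polynomial K) : Prop :=
  ∃ φ : MvPolynomial (Fin 2) K ≃ₐ[K] MvPolynomial (Fin 2) K,
    pm f g (φ (MvPolynomial.X 0)) = 0 ∧ pm f g (φ (MvPolynomial.X 1)) = Polynomial.X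

theorem Rect.el {f g : Polynomial K} (c : Polynomial K) (h : Rect f (g - c.comp f)) :
    Rect f g := by
  obtain ⟨φ, h1, h2⟩ := h
  exact ⟨φ.trans (elem c), by simpa [pm_elem] using h1, by simpa [pm_elem] using h2⟩

theorem Rect.sw {f g : Polynomial K} (h : Rect g f) : Rect f g := by
  obtain ⟨φ, h1, h2⟩ := h
  exact ⟨φ.trans AMSFin.sw, by simpa [pm_sw] using h1, by simpa [pm_sw] using h2⟩

theorem rect_lin {f g : Polynomial K} (hf : f.natDegree = 1) : Rect f g := by
  obtain ⟨u, hu, v, rfl⟩ := Polynomial.natDegree_eq_one.mp hf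
  apply Rect.el ((g - Polynomial.X).comp
    (Polynomial.C u⁻¹ * (Polynomial.X - Polynomial.C v)))
  have e : (Polynomial.C u⁻¹ * (Polynomial.X - Polynomial.C v)).comp
      (Polynomial.C u * Polynomial.X + Polynomial.C v) = Polynomial.X := by
    simp [← mul_assoc, ← Polynomial.C_mul, hu]
  rw [Polynomial.comp_assoc, e, Polynomial.comp_X, sub_sub_cancel]
  apply Rect.sw
  apply Rect.el (Polynomial.C u * Polynomial.X + Polynomial.C v)
  rw [Polynomial.comp_X, sub_self]
  apply Rect.sw
  exact ⟨AlgEquiv.refl, by simp [pm], by simp [pm]⟩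

theorem rect [CharZero K] (d : ℕ) : ∀ f g : Polynomial K, f.natDegree = d →
    Function.Surjective (pm f g) → Rect f g := by
  induction d using Nat.strong_induction_on with
  | _ d ih =>
  intro f g hd hs
  rcases Nat.lt_trichotomy d 1 with h | h | h
  · apply Rect.sw
    apply rect_lin
    obtain ⟨a, rfl⟩ : ∃ a, f = Polynomial.C a :=
      ⟨_, Polynomial.eq_C_of_natDegree_eq_zero (by omega)⟩
    obtain ⟨q, hq⟩ := hs Polynomial.X
    have : (Polynomial.aeval g).comp (pm (Polynomial.C a) Polynomial.X) =
        pm (Polynomial.C a) g := by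
      apply MvPolynomial.algHom_ext
      intro i
      fin_cases i
      · simp [pm]
      · simp [pm]
    rw [← this, AlgHom.comp_apply, ← Polynomial.comp_eq_aeval] at hq
    have h3 := congrArg Polynomial.natDegree hq
    rw [Polynomial.natDegree_comp, Polynomial.natDegree_X] at h3
    exact Nat.eq_one_of_mul_eq_one_left h3
  · exact rect_lin (hd.trans h)
  · obtain ⟨c, h1, h2⟩ := AMSConc.step f g (by omega) (by
      intro t
      obtain ⟨q, hq⟩ := hs t
      let T : MvPolynomial (Fin 2) K →+* Polynomial (Polynomial K) :=
        MvPolynomial.eval₂Hom (Polynomial.C.comp Polynomial.C)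
          ![Polynomial.C Polynomial.X, Polynomial.X]
      refine ⟨T q, ?_⟩
      have : (Polynomial.eval₂RingHom (Polynomial.compRingHom f) g).comp T =
          (pm f g : MvPolynomial (Fin 2) K →+* Polynomial K) := by
        apply MvPolynomial.ringHom_ext
        · intro r
          simp [T, pm]
        · intro i
          fin_cases i
          · simp [T, pm]
          · simp [T, pm]
      rw [← hq]
      exact DFunLike.congr_fun this q)
    apply Rect.el c
    apply Rect.sw
    refine ih _ (by omega) _ _ rfl ?_
    intro t
    obtain ⟨q, hq⟩ := hs t
    refine ⟨sw.symm ((elem c).symm q), ?_⟩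
    rw [← pm_sw, AlgEquiv.apply_symm_apply, ← pm_elem, AlgEquiv.apply_symm_apply, hq]

theorem ker_std (q : MvPolynomial (Fin 2) K) (hq : pm 0 Polynomial.X q = 0) :
    q ∈ Ideal.span {(MvPolynomial.X 0 : MvPolynomial (Fin 2) K)} := by
  have h : (Ideal.Quotient.mkₐ K (Ideal.span {(MvPolynomial.X 0 : MvPolynomial (Fin 2) K)})) =
      (Ideal.Quotient.mkₐ K (Ideal.span {(MvPolynomial.X 0 : MvPolynomial (Fin 2) K)})).comp
        ((Polynomial.aeval (MvPolynomial.X 1)).comp (pm 0 Polynomial.X)) := by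
    apply MvPolynomial.algHom_ext
    intro i
    fin_cases i
    · simp only [AlgHom.comp_apply, pm, MvPolynomial.aeval_X]
      simp only [Fin.zero_eta, Matrix.cons_val_zero, map_zero]
      exact Ideal.Quotient.eq_zero_iff_mem.mpr (Ideal.mem_span_singleton_self _)
    · simp [pm]
  have h2 := DFunLike.congr_fun h q
  rw [AlgHom.comp_apply, AlgHom.comp_apply, hq, map_zero, map_zero] at h2
  exact Ideal.Quotient.eq_zero_iff_mem.mp h2

/-- scaling -/
noncomputable def scHom (a : K) : MvPolynomial (Fin 2) K →ₐ[K] MvPolynomial (Fin 2) K :=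
  MvPolynomial.aeval ![MvPolynomial.C a * MvPolynomial.X 0, MvPolynomial.X 1]

theorem scHom_comp (a b : K) (h : a * b = 1) :
    (scHom a).comp (scHom b) = AlgHom.id K _ := by
  apply MvPolynomial.algHom_ext
  intro i
  fin_cases i
  · simp only [scHom, AlgHom.comp_apply, MvPolynomial.aeval_X]
    simp only [Fin.zero_eta, Matrix.cons_val_zero, map_mul, MvPolynomial.aeval_X,
      MvPolynomial.aeval_C, MvPolynomial.algebraMap_eq, AlgHom.coe_id, id_eq]
    rw [← mul_assoc, ← MvPolynomial.C_mul, mul_comm b a, h, MvPolynomial.C_1, one_mul]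
  · simp [scHom]

theorem main [CharZero K] (p : MvPolynomial (Fin 2) K)
    (h : Nonempty ((MvPolynomial (Fin 2) K ⧸ Ideal.span {p}) ≃ₐ[K] Polynomial K)) :
    ∃ φ : MvPolynomial (Fin 2) K ≃ₐ[K] MvPolynomial (Fin 2) K, φ p = MvPolynomial.X 0 := by
  obtain ⟨e⟩ := h
  let π : MvPolynomial (Fin 2) K →ₐ[K] Polynomial K :=
    e.toAlgHom.comp (Ideal.Quotient.mkₐ K (Ideal.span {p}))
  have hπs : Function.Surjective π :=
    e.surjective.comp (Ideal.Quotient.mkₐ_surjective K _)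
  have hπk : ∀ q, π q = 0 ↔ q ∈ Ideal.span {p} := by
    intro q
    change e _ = 0 ↔ _
    rw [map_eq_zero_iff e e.injective]
    exact Ideal.Quotient.eq_zero_iff_mem
  have hπ : π = pm (π (MvPolynomial.X 0)) (π (MvPolynomial.X 1)) := by
    apply MvPolynomial.algHom_ext
    intro i
    fin_cases i <;> simp [pm]
  obtain ⟨φ, h0, h1⟩ := rect _ (π (MvPolynomial.X 0)) (π (MvPolynomial.X 1)) rfl (hπ ▸ hπs)
  rw [← hπ] at h0 h1
  have hcomp : π.comp φ.toAlgHom = pm 0 Polynomial.X := by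
    apply MvPolynomial.algHom_ext
    intro i
    fin_cases i
    · simpa [pm] using h0
    · simpa [pm] using h1
  have hd1 : MvPolynomial.X 0 ∣ φ.symm p := by
    rw [← Ideal.mem_span_singleton]
    apply ker_std
    rw [← hcomp]
    change π (φ (φ.symm p)) = 0
    rw [AlgEquiv.apply_symm_apply, hπk]
    exact Ideal.mem_span_singleton_self p
  have hd2 : φ.symm p ∣ MvPolynomial.X 0 := by
    have h3 := (hπk _).mp h0
    rw [Ideal.mem_span_singleton] at h3
    have := map_dvd φ.symm h3
    simpa using this
  obtain ⟨u, hu⟩ := associated_of_dvd_dvd hd1 hd2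
  obtain ⟨a, ha, hau⟩ := MvPolynomial.isUnit_iff_eq_C_of_isReduced.mp u.isUnit
  have ha0 : a ≠ 0 := ha.ne_zero
  let S : MvPolynomial (Fin 2) K ≃ₐ[K] MvPolynomial (Fin 2) K :=
    AlgEquiv.ofAlgHom (scHom a⁻¹) (scHom a) (scHom_comp _ _ (inv_mul_cancel₀ ha0))
      (scHom_comp _ _ (mul_inv_cancel₀ ha0))
  refine ⟨φ.symm.trans S, ?_⟩
  rw [AlgEquiv.trans_apply, ← hu, hau]
  change scHom a⁻¹ _ = _
  simp only [scHom, map_mul, MvPolynomial.aeval_X, MvPolynomial.aeval_C]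
  simp only [Matrix.cons_val_zero, MvPolynomial.algebraMap_eq]
  rw [mul_right_comm, ← MvPolynomial.C_mul, inv_mul_cancel₀ ha0, MvPolynomial.C_1, one_mul]

end
end AMSFin

open MvPolynomial

/-- **Abhyankar–Moh–Suzuki theorem** over an arbitrary algebraically closed field of
characteristic zero: if `K[x,y]/(p) ≅ K[t]` as `K`-algebras, then some `K`-algebra
automorphism of `K[x,y]` carries `p` to `x`. -/
theorem abhyankar_moh_suzuki_alg_closed
    (K : Type*) [Field K] [IsAlgClosed K] [CharZero K]
    (p : MvPolynomial (Fin 2) K)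
    (h : Nonempty ((MvPolynomial (Fin 2) K ⧸ Ideal.span {p}) ≃ₐ[K] Polynomial K)) :
    ∃ φ : MvPolynomial (Fin 2) K ≃ₐ[K] MvPolynomial (Fin 2) K,
      φ p = X 0 := by
  exact AMSFin.main p h
end

section
/- Let q ∈ ℂ[x,y] be a polynomial such that the quotient ℂ-algebra ℂ[x,y]/(q) is isomorphic as a ℂ-algebra to ℂ[t]. Then for all nonzero complex numbers c and c′, the ℂ-algebras ℂ[x,y]/(q − c) and ℂ[x,y]/(q − c′) are isomorphic; i.e., all nonzero fibers of q are pairwise isomorphic as affine curves. -/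
section
open Polynomial

namespace AMS

abbrev K := RatFunc ℂ
noncomputable abbrev D (a : K) : ℤ := RatFunc.intDegree a

theorem D_mul {a b : K} (ha : a ≠ 0) (hb : b ≠ 0) : D (a * b) = D a + D b :=
  RatFunc.intDegree_mul ha hb

theorem D_pow {a : K} (ha : a ≠ 0) (i : ℕ) : D (a ^ i) = i * D a := by
  induction i with
  | zero => simp [D]
  | succ i ih => rw [pow_succ, D_mul (pow_ne_zero _ ha) ha, ih]; push_cast; ring

theorem D_add_le {a b : K} {m : ℤ} (ha : a ≠ 0 → D a ≤ m) (hb : b ≠ 0 → D b ≤ m)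
    (hab : a + b ≠ 0) : D (a + b) ≤ m := by
  by_cases h0 : a = 0
  · subst h0; simp only [zero_add] at hab ⊢; exact hb hab
  by_cases h1 : b = 0
  · subst h1; simp only [add_zero] at hab ⊢; exact ha hab
  exact (RatFunc.intDegree_add_le h1 hab).trans (max_le (ha h0) (hb h1))

/-- dominant term -/
theorem D_add_dom {a b : K} (ha : a ≠ 0) (hb : b ≠ 0 → D b < D a) :
    a + b ≠ 0 ∧ D (a + b) = D a := by
  by_cases h1 : b = 0
  · subst h1; simp [ha]
  have hlt := hb h1
  have hne : a + b ≠ 0 := by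
    intro h
    have : b = -a := by linear_combination h
    rw [this] at hlt
    simp [D, RatFunc.intDegree_neg] at hlt
  refine ⟨hne, le_antisymm (D_add_le (fun _ => le_rfl) (fun _ => hlt.le) hne) ?_⟩
  by_contra hc
  push Not at hc
  have h2 : (a + b) + (-b) ≠ 0 := by simpa using ha
  have h3 : D ((a + b) + (-b)) ≤ max (D (a + b)) (D b) := 
    D_add_le (fun _ => le_max_left _ _) (fun _ => by
      rw [show D (-b) = D b from RatFunc.intDegree_neg b]; exact le_max_right _ _) h2
  rw [add_neg_cancel_right] at h3
  rcases le_max_iff.1 h3 with h | h <;> omega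

theorem D_sum_lt {s : Finset ℕ} {a : ℕ → K} {m : ℤ} (h : ∀ i ∈ s, a i ≠ 0 → D (a i) < m)
    (h0 : ∑ i ∈ s, a i ≠ 0) : D (∑ i ∈ s, a i) < m := by
  classical
  induction s using Finset.induction_on with
  | empty => simp at h0
  | insert i s hi ih =>
    rw [Finset.sum_insert hi] at h0 ⊢
    have := D_add_le (m := m - 1) (a := a i) (b := ∑ i ∈ s, a i)
      (fun h' => by have := h i (by simp) h'; omega)
      (fun h' => by have := ih (fun j hj => h j (by simp [hj])) h'; omega) h0
    omega

theorem D_sum {s : Finset ℕ} {a : ℕ → K}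
    (hd : ∀ i ∈ s, ∀ j ∈ s, a i ≠ 0 → a j ≠ 0 → D (a i) = D (a j) → i = j)
    (hne : ∃ i ∈ s, a i ≠ 0) :
    ∑ i ∈ s, a i ≠ 0 ∧ ∃ i ∈ s, a i ≠ 0 ∧ D (∑ i ∈ s, a i) = D (a i) ∧
      ∀ j ∈ s, a j ≠ 0 → D (a j) ≤ D (a i) := by
  classical
  obtain ⟨i, hi, hmax⟩ := Finset.exists_max_image (s.filter (fun i => a i ≠ 0)) (fun i => D (a i))
    (by obtain ⟨i, h1, h2⟩ := hne; exact ⟨i, by simp [h1, h2]⟩)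
  rw [Finset.mem_filter] at hi
  obtain ⟨his, hi0⟩ := hi
  have key := D_add_dom (a := a i) (b := ∑ j ∈ s.erase i, a j) hi0 (fun h0 => by
    apply D_sum_lt _ h0
    intro j hj hj0
    have hj' := Finset.mem_erase.1 hj
    refine lt_of_le_of_ne (hmax j (by simp [hj'.2, hj0])) ?_
    intro h
    exact hj'.1 (hd j hj'.2 i his hj0 hi0 h))
  rw [Finset.add_sum_erase _ _ his] at key
  exact ⟨key.1, i, his, hi0, key.2, fun j hj hj0 => hmax j (by simp [hj, hj0])⟩

/-- base expansion -/
theorem expand {A : Type*} [CommRing A] [Nontrivial A] (φ : A[X]) (hm : φ.Monic) (k : ℕ)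
    (hk : φ.natDegree = k) (e : ℕ) :
    ∀ P : A[X], P.degree < ((e * k : ℕ) : WithBot ℕ) → ∃ p : ℕ → A[X],
      (∀ i, (p i).degree < (k : WithBot ℕ)) ∧ P = ∑ i ∈ Finset.range e, p i * φ ^ i := by
  have hφd : φ.degree = (k : WithBot ℕ) := by rw [degree_eq_natDegree hm.ne_zero, hk]
  induction e with
  | zero =>
    intro P hP
    refine ⟨fun _ => 0, by simp, ?_⟩
    simp at hP
    simp [hP]
  | succ e ih =>
    intro P hP
    have hq : (P /ₘ φ).degree < ((e * k : ℕ) : WithBot ℕ) := by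
      by_cases h0 : P /ₘ φ = 0
      · rw [h0, degree_zero]; exact WithBot.bot_lt_coe _
      rw [← natDegree_lt_iff_degree_lt h0, natDegree_divByMonic _ hm, hk]
      have hP0 : P ≠ 0 := by rintro rfl; simp at h0
      rw [← natDegree_lt_iff_degree_lt hP0] at hP
      have : φ.natDegree ≤ P.natDegree := by
        by_contra hc
        push Not at hc
        exact h0 ((divByMonic_eq_zero_iff hm).2 (degree_lt_degree hc))
      rw [add_mul] at hP
      omega
    obtain ⟨p, hp, hpe⟩ := ih _ hq
    refine ⟨fun i => if i = 0 then P %ₘ φ else p (i - 1), ?_, ?_⟩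
    · intro i
      dsimp only
      split_ifs
      · rw [← hφd]; exact degree_modByMonic_lt _ hm
      · exact hp _
    · rw [Finset.sum_range_succ']
      simp only [Nat.add_eq_zero_iff, one_ne_zero, and_false, if_false, Nat.add_sub_cancel, if_true, pow_zero, mul_one]
      conv_lhs => rw [← modByMonic_add_div P φ, hpe]
      rw [add_comm, Finset.mul_sum]
      congr 1
      apply Finset.sum_congr rfl
      intros; ring

theorem add_pow_aux {A : Type*} [CommRing A] (φ w : A[X]) (k : ℕ) (hφ : φ.natDegree ≤ k)
    (hw : w.natDegree ≤ k) (e : ℕ) : ∃ Z : A[X], Z.natDegree ≤ e * k ∧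
      (φ + w) ^ (e + 2) = φ ^ (e + 2) + ((e + 2 : ℕ) : A[X]) * φ ^ (e + 1) * w + w ^ 2 * Z := by
  induction e with
  | zero => exact ⟨1, by simp, by push_cast; ring⟩
  | succ e ih =>
    obtain ⟨Z, hZ, h⟩ := ih
    refine ⟨((e + 2 : ℕ) : A[X]) * φ ^ (e + 1) + Z * φ + Z * w, ?_, ?_⟩
    · have h1 : (φ ^ (e+1)).natDegree ≤ (e + 1) * k :=
        natDegree_pow_le.trans (Nat.mul_le_mul le_rfl hφ)
      have h2 : (((e + 2 : ℕ) : A[X]) * φ ^ (e + 1)).natDegree ≤ (e + 1) * k := by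
        refine natDegree_mul_le.trans ?_
        rw [natDegree_natCast]; omega
      have h3 : (Z * φ).natDegree ≤ (e + 1) * k := by
        refine natDegree_mul_le.trans ?_
        rw [add_mul]; omega
      have h4 : (Z * w).natDegree ≤ (e + 1) * k := by
        refine natDegree_mul_le.trans ?_
        rw [add_mul]; omega
      exact natDegree_add_le_of_degree_le (natDegree_add_le_of_degree_le h2 h3) h4
    · rw [pow_succ, h]; push_cast; ring

/-- Tschirnhaus step -/
theorem tschirn {A : Type*} [CommRing A] [IsDomain A] (φ Φ : A[X]) (hm : φ.Monic) (k e l : ℕ)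
    (hk : φ.natDegree = k) (he : 2 ≤ e) (u : A) (hu : (e : A) * u = 1) (hl : l < k)
    (hd : (Φ - φ ^ e).degree < ((l + 1 + (e - 1) * k : ℕ) : WithBot ℕ)) :
    ((Φ - φ ^ e) /ₘ φ ^ (e - 1)).natDegree ≤ l ∧
    (Φ - (φ + C u * ((Φ - φ ^ e) /ₘ φ ^ (e - 1))) ^ e).degree < 
      ((l + (e - 1) * k : ℕ) : WithBot ℕ) := by
  obtain ⟨e, rfl⟩ : ∃ e', e = e' + 2 := ⟨e - 2, by omega⟩
  simp only [show e + 2 - 1 = e + 1 from rfl] at *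
  set E := Φ - φ ^ (e + 2) with hE
  set p := E /ₘ φ ^ (e + 1) with hp
  have hmp : (φ ^ (e + 1)).Monic := hm.pow _
  have hdp : (φ ^ (e + 1)).natDegree = (e + 1) * k := by rw [hm.natDegree_pow, hk]
  have hpl : p.natDegree ≤ l := by
    rw [hp, natDegree_divByMonic _ hmp, hdp]
    by_cases hE0 : E = 0
    · simp [hE0]
    · rw [← natDegree_lt_iff_degree_lt hE0] at hd
      omega
  refine ⟨hpl, ?_⟩
  set w := C u * p with hw
  have hwl : w.natDegree ≤ l := natDegree_C_mul_le _ _ |>.trans hpl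
  obtain ⟨Z, hZ, h⟩ := add_pow_aux φ w k hk.le (by omega) e
  have hr := modByMonic_add_div E (φ ^ (e + 1))
  have hu' : ((e + 2 : ℕ) : A[X]) * C u = 1 := by
    rw [← map_natCast C, ← C_mul, hu, C_1]
  have key : Φ - (φ + w) ^ (e + 2) = E %ₘ φ ^ (e + 1) - w ^ 2 * Z := by
    rw [h, hw]
    have : Φ = E + φ ^ (e + 2) := by rw [hE]; ring
    rw [this, ← hp] at *
    linear_combination (φ ^ (e+1) * p) * (-hu') - hr
  rw [key]
  have hrd : (E %ₘ φ ^ (e + 1)).degree < ((l + (e + 1) * k : ℕ) : WithBot ℕ) := by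
    refine (degree_modByMonic_lt _ hmp).trans_le ?_
    rw [degree_eq_natDegree hmp.ne_zero, hdp]
    exact_mod_cast Nat.le_add_left _ _
  refine (degree_sub_le _ _).trans_lt (max_lt hrd ?_)
  refine degree_le_natDegree.trans_lt ?_
  norm_cast
  have h5 : (w ^ 2).natDegree ≤ 2 * l := natDegree_pow_le.trans (by omega)
  refine natDegree_mul_le.trans_lt ?_
  rw [add_mul]; omega

theorem approx_unique {A : Type*} [CommRing A] [IsDomain A] [CharZero A] (φ ψ Φ : A[X])
    (hm : φ.Monic) (hm' : ψ.Monic) (k e : ℕ)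
    (hk : φ.natDegree = k) (hk' : ψ.natDegree = k) (he : 1 ≤ e)
    (hd : (Φ - φ ^ e).degree < (((e - 1) * k : ℕ) : WithBot ℕ))
    (hd' : (Φ - ψ ^ e).degree < (((e - 1) * k : ℕ) : WithBot ℕ)) : φ = ψ := by
  by_contra hne
  have hg := (Commute.all φ ψ).geom_sum₂_mul e
  set G := ∑ i ∈ Finset.range e, φ ^ i * ψ ^ (e - 1 - i) with hG
  have hlt : (G * (φ - ψ)).degree < (((e - 1) * k : ℕ) : WithBot ℕ) := by
    rw [hg, show φ ^ e - ψ ^ e = (Φ - ψ ^ e) - (Φ - φ ^ e) by ring]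
    exact (degree_sub_le _ _).trans_lt (max_lt hd' hd)
  have hc : G.coeff ((e - 1) * k) = e := by
    rw [hG, finsetSum_coeff, Finset.sum_congr rfl (g := fun _ => (1 : A))]
    · simp
    · intro i hi
      have hi' := Finset.mem_range.1 hi
      have hmm : (φ ^ i * ψ ^ (e - 1 - i)).Monic := (hm.pow _).mul (hm'.pow _)
      have hdd : (φ ^ i * ψ ^ (e - 1 - i)).natDegree = (e - 1) * k := by
        rw [(hm.pow _).natDegree_mul (hm'.pow _), hm.natDegree_pow, hm'.natDegree_pow, hk, hk',
          ← add_mul]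
        congr 1; omega
      rw [← hdd]; exact hmm
  have hG0 : ((e - 1) * k : ℕ) ≤ G.degree := le_degree_of_ne_zero (by
    rw [hc]; exact_mod_cast (by omega))
  have h0 : φ - ψ ≠ 0 := sub_ne_zero.2 hne
  rw [degree_mul, degree_eq_natDegree h0] at hlt
  have : G.degree ≤ G.degree + ((φ - ψ).natDegree : WithBot ℕ) := by
    conv_lhs => rw [← add_zero G.degree]
    gcongr
    exact_mod_cast Nat.zero_le _
  exact absurd hlt (not_lt.2 (hG0.trans this))

theorem sub_monic {A : Type*} [CommRing A] [Nontrivial A] {Φ Ψ : A[X]} (hm : Φ.Monic)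
    (hm' : Ψ.Monic) {N : ℕ} (h : Φ.natDegree = N) (h' : Ψ.natDegree = N) :
    (Φ - Ψ).degree < (N : WithBot ℕ) := by
  have h1 : Φ.degree = (N : WithBot ℕ) := by rw [degree_eq_natDegree hm.ne_zero, h]
  have h2 : Ψ.degree = (N : WithBot ℕ) := by rw [degree_eq_natDegree hm'.ne_zero, h']
  rw [← h1]
  exact degree_sub_lt_left (h1.trans h2.symm) hm.ne_zero (by rw [hm.leadingCoeff, hm'.leadingCoeff])

theorem approx_exists {A : Type*} [CommRing A] [IsDomain A] (Φ : A[X]) (k e : ℕ)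
    (hm : Φ.Monic) (hk : Φ.natDegree = e * k) (he : 2 ≤ e) (u : A) (hu : (e : A) * u = 1) :
    ∃ φ : A[X], φ.Monic ∧ φ.natDegree = k ∧
      (Φ - φ ^ e).degree < (((e - 1) * k : ℕ) : WithBot ℕ) := by
  have main : ∀ l : ℕ, l ≤ k → ∃ φ : A[X], φ.Monic ∧ φ.natDegree = k ∧
      (Φ - φ ^ e).degree < ((k - l + (e - 1) * k : ℕ) : WithBot ℕ) := by
    intro l
    induction l with
    | zero =>
      intro _
      refine ⟨X ^ k, monic_X_pow k, natDegree_X_pow k, ?_⟩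
      have h1 : k - 0 + (e - 1) * k = e * k := by
        obtain ⟨e, rfl⟩ : ∃ e', e = e' + 1 := ⟨e - 1, by omega⟩
        simp only [Nat.add_sub_cancel, Nat.sub_zero]; ring
      rw [h1]
      have hm2 : ((X ^ k : A[X]) ^ e).Monic := (monic_X_pow k).pow e
      exact sub_monic hm hm2 hk (by rw [(monic_X_pow k).natDegree_pow, natDegree_X_pow])
    | succ l ih =>
      intro hl
      obtain ⟨φ, h1, h2, h3⟩ := ih (by omega)
      obtain ⟨h4, h5⟩ := tschirn φ Φ h1 k e (k - (l + 1)) h2 he u hu (by omega)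
        (by rwa [show k - (l + 1) + 1 = k - l by omega])
      have h6 : (C u * ((Φ - φ ^ e) /ₘ φ ^ (e - 1))).degree < φ.degree := by
        refine degree_lt_degree ?_
        have := natDegree_C_mul_le u ((Φ - φ ^ e) /ₘ φ ^ (e - 1))
        omega
      refine ⟨_, h1.add_of_left h6, ?_, h5⟩
      rw [natDegree_add_eq_left_of_degree_lt h6, h2]
  obtain ⟨φ, h1, h2, h3⟩ := main k le_rfl
  exact ⟨φ, h1, h2, by simpa using h3⟩

end AMS

end

section
open Polynomial
namespace AMS

noncomputable abbrev ev (ι : K →+* K) (g : K) : K[X] →+* K := eval₂RingHom ι g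

def Good (ι : K →+* K) (g : K) (k d : ℕ) : Prop :=
  ∀ P : K[X], P ≠ 0 → P.degree < (k : WithBot ℕ) → ev ι g P ≠ 0 ∧ (d : ℤ) ∣ D (ev ι g P)

theorem dist {ι : K →+* K} {g : K} {k d : ℕ} (hG : Good ι g k d) {φ : K[X]} {δ : ℤ}
    (hφ0 : ev ι g φ ≠ 0) (hδ : D (ev ι g φ) = δ) {e : ℕ}
    (hi : ∀ i : ℕ, 0 < i → i < e → ¬ (d : ℤ) ∣ i * δ) (p : ℕ → K[X])
    (hp : ∀ i, (p i).degree < (k : WithBot ℕ)) (hne : ∃ i < e, p i ≠ 0) :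
    ev ι g (∑ i ∈ Finset.range e, p i * φ ^ i) ≠ 0 ∧
    ∃ i < e, p i ≠ 0 ∧ D (ev ι g (∑ i ∈ Finset.range e, p i * φ ^ i)) = D (ev ι g (p i)) + i * δ ∧
      ∀ j < e, p j ≠ 0 →
        D (ev ι g (p j)) + j * δ ≤ D (ev ι g (∑ i ∈ Finset.range e, p i * φ ^ i)) := by
  have hD : ∀ i, p i ≠ 0 → D (ev ι g (p i) * ev ι g φ ^ i) = D (ev ι g (p i)) + i * δ := by
    intro i h0
    rw [D_mul (hG _ h0 (hp i)).1 (pow_ne_zero _ hφ0), D_pow hφ0, hδ]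
  have hz : ∀ i, ev ι g (p i) * ev ι g φ ^ i ≠ 0 ↔ p i ≠ 0 := by
    intro i
    constructor
    · rintro h rfl'
      apply h; rw [rfl', map_zero, zero_mul]
    · intro h; exact mul_ne_zero (hG _ h (hp i)).1 (pow_ne_zero _ hφ0)
  have hsum : ev ι g (∑ i ∈ Finset.range e, p i * φ ^ i) =
      ∑ i ∈ Finset.range e, ev ι g (p i) * ev ι g φ ^ i := by
    rw [map_sum]; simp only [map_mul, map_pow]
  have hlt : ∀ i j : ℕ, i < j → j < e → p i ≠ 0 → p j ≠ 0 →
      D (ev ι g (p i)) + i * δ ≠ D (ev ι g (p j)) + j * δ := by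
    intro i j hij hj h1 h2 h
    apply hi (j - i) (by omega) (by omega)
    have : ((j - i : ℕ) : ℤ) * δ = D (ev ι g (p i)) - D (ev ι g (p j)) := by
      rw [Nat.cast_sub hij.le]; linear_combination -h
    rw [this]
    exact dvd_sub (hG _ h1 (hp i)).2 (hG _ h2 (hp j)).2
  obtain ⟨h1, i, hi1, hi2, hi3, hi4⟩ := D_sum (s := Finset.range e)
    (a := fun i => ev ι g (p i) * ev ι g φ ^ i) (by
      intro i hi' j hj' h1 h2 h
      simp only [Finset.mem_range] at hi' hj'
      rw [hz] at h1 h2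
      rw [hD i h1, hD j h2] at h
      rcases lt_trichotomy i j with hlt' | heq | hlt'
      · exact absurd h (hlt i j hlt' hj' h1 h2)
      · exact heq
      · exact absurd h.symm (hlt j i hlt' hi' h2 h1))
    (by obtain ⟨i, h1, h2⟩ := hne; exact ⟨i, by simpa using h1, (hz i).2 h2⟩)
  rw [hsum]
  refine ⟨h1, i, by simpa using hi1, (hz i).1 hi2, by rw [hi3, hD i ((hz i).1 hi2)], ?_⟩
  intro j hj hj0
  rw [hi3, ← hD j hj0]
  exact hi4 j (by simpa using hj) ((hz j).2 hj0)

theorem good_step {ι : K →+* K} {g : K} {k d : ℕ} (hG : Good ι g k d) (hd : 0 < d) {φ : K[X]}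
    (hm : φ.Monic) (hk : φ.natDegree = k) {δ : ℤ}
    (hφ0 : ev ι g φ ≠ 0) (hδ : D (ev ι g φ) = δ) (hnd : ¬ (d : ℤ) ∣ δ) :
    ∃ e d' : ℕ, 2 ≤ e ∧ d = e * d' ∧ Good ι g (e * k) d' ∧ (d' : ℤ) ∣ δ ∧
      ∀ i : ℕ, 0 < i → i < e → ¬ (d : ℤ) ∣ i * δ := by
  obtain ⟨e, he⟩ : ∃ e : ℕ, d = Int.gcd d δ * e := by
    have : Int.gcd d δ ∣ d := by exact_mod_cast Int.gcd_dvd_left (d : ℤ) δ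
    exact this
  set d' := Int.gcd d δ with hd'
  have hd'0 : 0 < d' := by
    rcases Nat.eq_zero_or_pos d' with h | h
    · rw [h] at he; omega
    · exact h
  obtain ⟨δ', hδ'⟩ : (d' : ℤ) ∣ δ := Int.gcd_dvd_right (d : ℤ) δ
  have hcop : Int.gcd (e : ℤ) δ' = 1 := by
    have h1 : Int.gcd ((d' : ℤ) * e) (d' * δ') = d' * Int.gcd e δ' := by
      rw [Int.gcd_mul_left]; simp
    have h2 : ((d' : ℤ) * e) = d := by exact_mod_cast he.symm
    rw [h2, ← hδ', ← hd'] at h1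
    exact Nat.eq_of_mul_eq_mul_left hd'0 (by rw [← h1, mul_one])
  have hi : ∀ i : ℕ, 0 < i → i < e → ¬ (d : ℤ) ∣ i * δ := by
    intro i h0 hie hdv
    rw [he, hδ'] at hdv
    push_cast at hdv
    rw [show (i : ℤ) * (d' * δ') = d' * (i * δ') by ring] at hdv
    have h3 : (e : ℤ) ∣ i * δ' := Int.dvd_of_mul_dvd_mul_left (by exact_mod_cast hd'0.ne') hdv
    have h4 : (e : ℤ) ∣ i := (Int.isCoprime_iff_gcd_eq_one.2 hcop).dvd_of_dvd_mul_right h3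
    have h5 : e ∣ i := by exact_mod_cast h4
    exact absurd (Nat.le_of_dvd h0 h5) (by omega)
  have he2 : 2 ≤ e := by
    by_contra hc
    have : e = 0 ∨ e = 1 := by omega
    rcases this with rfl | rfl
    · omega
    · apply hnd; rw [he]; simp [hδ']
  refine ⟨e, d', he2, by rw [mul_comm]; exact he, ?_, ⟨δ', hδ'⟩, hi⟩
  intro P hP0 hPd
  obtain ⟨p, hp, rfl⟩ := expand φ hm k hk e P hPd
  obtain ⟨h1, i, hie, hi0, h2, -⟩ := dist hG hφ0 hδ hi p hp (by
    by_contra hc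
    push Not at hc
    apply hP0
    apply Finset.sum_eq_zero
    intro i hi; rw [hc i (by simpa using hi), zero_mul])
  refine ⟨h1, ?_⟩
  rw [h2]
  apply dvd_add
  · exact dvd_trans ⟨(e : ℤ), by exact_mod_cast he⟩ (hG _ hi0 (hp i)).2
  · rw [hδ']; exact ⟨i * δ', by ring⟩

theorem D_inv_nat (e : ℕ) : D ((e : K)⁻¹) = 0 := by
  have : (e : K) = RatFunc.C (e : ℂ) := by simp
  rw [D, RatFunc.intDegree_inv, this, RatFunc.intDegree_C, neg_zero]

theorem improve {ι : K →+* K} {g : K} {k d d' e : ℕ} (hG : Good ι g k d)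
    (he : 2 ≤ e) (hG' : Good ι g (e * k) d') {δ : ℤ}
    (hi : ∀ i : ℕ, 0 < i → i < e → ¬ (d : ℤ) ∣ i * δ) {Φ : K[X]} (hΦm : Φ.Monic)
    (hΦk : Φ.natDegree = e * k) (hΦ : ev ι g Φ = 0 ∨ ¬ (d' : ℤ) ∣ D (ev ι g Φ))
    {φ : K[X]} (hm : φ.Monic) (hk : φ.natDegree = k)
    (hφ0 : ev ι g φ ≠ 0) (hδ : D (ev ι g φ) = δ) :
    ∃ ψ : K[X], ψ.Monic ∧ ψ.natDegree = k ∧ ev ι g ψ ≠ 0 ∧ D (ev ι g ψ) = δ ∧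
      (Φ - ψ ^ e).degree < (((e - 1) * k : ℕ) : WithBot ℕ) := by
  have hek : ∀ l, l ≤ k → k - l + (e - 1) * k = e * k - l := by
    intro l hl
    obtain ⟨e, rfl⟩ : ∃ e', e = e' + 1 := ⟨e - 1, by omega⟩
    simp only [Nat.add_sub_cancel, add_mul]; omega
  have bound : ∀ φ : K[X], φ.Monic → φ.natDegree = k → ev ι g φ ≠ 0 → D (ev ι g φ) = δ →
      (Φ - φ ^ e) /ₘ φ ^ (e - 1) ≠ 0 → ev ι g ((Φ - φ ^ e) /ₘ φ ^ (e - 1)) ≠ 0 ∧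
        D (ev ι g ((Φ - φ ^ e) /ₘ φ ^ (e - 1))) < δ := by
    intro φ hm hk hφ0 hδ hp0
    have hEd := sub_monic hΦm (hm.pow e) hΦk (by rw [hm.natDegree_pow, hk])
    have hE0 : Φ - φ ^ e ≠ 0 := by
      intro h; rw [h] at hp0; simp at hp0
    obtain ⟨p, hp, hEp⟩ := expand φ hm k hk e _ hEd
    have hpe : (Φ - φ ^ e) /ₘ φ ^ (e - 1) = p (e - 1) := by
      refine (div_modByMonic_unique (p (e - 1)) (∑ i ∈ Finset.range (e - 1), p i * φ ^ i)
        (hm.pow _) ⟨?_, ?_⟩).1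
      · rw [hEp]
        obtain ⟨e, rfl⟩ : ∃ e', e = e' + 1 := ⟨e - 1, by omega⟩
        rw [Finset.sum_range_succ]
        simp only [Nat.add_sub_cancel]; ring
      · rw [degree_eq_natDegree (hm.pow _).ne_zero, hm.natDegree_pow, hk]
        refine (degree_sum_le _ _).trans_lt ?_
        rw [Finset.sup_lt_iff (WithBot.bot_lt_coe _)]
        intro i hi
        have hi' := Finset.mem_range.1 hi
        by_cases h0 : p i = 0
        · rw [h0, zero_mul, degree_zero]; exact WithBot.bot_lt_coe _
        have h1 := (natDegree_lt_iff_degree_lt h0).2 (hp i)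
        refine degree_le_natDegree.trans_lt ?_
        norm_cast
        refine natDegree_mul_le.trans_lt ?_
        rw [hm.natDegree_pow, hk]
        calc (p i).natDegree + i * k < k + i * k := by omega
          _ = (i + 1) * k := by ring
          _ ≤ _ := Nat.mul_le_mul (by omega) le_rfl
    rw [hpe] at hp0 ⊢
    obtain ⟨h1, -, -, -, -, h2⟩ := dist hG hφ0 hδ hi p hp ⟨e - 1, by omega, hp0⟩
    rw [← hEp] at h1 h2
    have h3 := h2 (e - 1) (by omega) hp0
    obtain ⟨h5, h4⟩ := hG _ hp0 (hp (e - 1))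
    have hE := hG' _ hE0 hEd
    have hpe : D (ev ι g φ ^ e) = e * δ := by rw [D_pow hφ0, hδ]
    have h6 : D (ev ι g (Φ - φ ^ e)) ≤ e * δ := by
      by_contra hc
      push Not at hc
      have h7 := D_add_dom (a := ev ι g (Φ - φ ^ e)) (b := ev ι g φ ^ e) h1
        (fun _ => by rw [hpe]; exact hc)
      rw [map_sub, map_pow, sub_add_cancel] at h7
      rcases hΦ with h8 | h8
      · exact h7.1 h8
      · apply h8; rw [h7.2, ← map_pow, ← map_sub]; exact hE.2
    have h9 : D (ev ι g (p (e - 1))) ≤ δ := by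
      have : ((e - 1 : ℕ) : ℤ) = e - 1 := by omega
      rw [this] at h3
      linarith
    refine ⟨h5, lt_of_le_of_ne h9 ?_⟩
    intro h
    apply hi 1 (by omega) (by omega)
    rw [h] at h4
    simpa using h4
  have main : ∀ l : ℕ, l ≤ k → ∃ φ : K[X], φ.Monic ∧ φ.natDegree = k ∧ ev ι g φ ≠ 0 ∧
      D (ev ι g φ) = δ ∧ (Φ - φ ^ e).degree < ((k - l + (e - 1) * k : ℕ) : WithBot ℕ) := by
    intro l
    induction l with
    | zero =>
      intro h
      refine ⟨φ, hm, hk, hφ0, hδ, ?_⟩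
      rw [hek 0 h]
      exact sub_monic hΦm (hm.pow e) hΦk (by rw [hm.natDegree_pow, hk]; rfl)
    | succ l ih =>
      intro hl
      obtain ⟨φ, h1, h2, h0, hδ', h3⟩ := ih (by omega)
      have hu : (e : K) * (e : K)⁻¹ = 1 := mul_inv_cancel₀ (by exact_mod_cast (by omega))
      obtain ⟨h4, h5⟩ := tschirn φ Φ h1 k e (k - (l + 1)) h2 he _ hu (by omega)
        (by rwa [show k - (l + 1) + 1 = k - l by omega])
      have h6 : (C (e : K)⁻¹ * ((Φ - φ ^ e) /ₘ φ ^ (e - 1))).degree < φ.degree := by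
        refine degree_lt_degree ?_
        have := natDegree_C_mul_le (e : K)⁻¹ ((Φ - φ ^ e) /ₘ φ ^ (e - 1))
        omega
      have h7 := D_add_dom (a := ev ι g φ)
        (b := ev ι g (C (e : K)⁻¹ * ((Φ - φ ^ e) /ₘ φ ^ (e - 1)))) h0 (by
          intro hne
          have hne' : (Φ - φ ^ e) /ₘ φ ^ (e - 1) ≠ 0 := by
            intro h; apply hne; rw [h, mul_zero, map_zero]
          obtain ⟨h8, h9⟩ := bound φ h1 h2 h0 hδ' hne'
          have h10 : ev ι g (C (e : K)⁻¹) = (e : K)⁻¹ := by simp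
          rw [map_mul, h10] at hne ⊢
          rw [D_mul (left_ne_zero_of_mul hne) h8, D_inv_nat, hδ']
          omega)
      rw [← map_add] at h7
      refine ⟨_, h1.add_of_left h6, ?_, h7.1, h7.2.trans hδ', h5⟩
      rw [natDegree_add_eq_left_of_degree_lt h6, h2]
  obtain ⟨φ, h1, h2, h0, h3, h4⟩ := main k le_rfl
  exact ⟨φ, h1, h2, h0, h3, by simpa using h4⟩
end AMS

end

section
open Polynomial
namespace AMS

noncomputable abbrev evR (f g : ℂ[X]) : ℂ[X][X] →+* ℂ[X] := eval₂RingHom (compRingHom f) g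

noncomputable abbrev toK : ℂ[X] →+* K := algebraMap ℂ[X] K

theorem toK_inj : Function.Injective toK := IsFractionRing.injective ℂ[X] K

theorem toK_ne {p : ℂ[X]} : toK p ≠ 0 ↔ p ≠ 0 := by
  rw [ne_eq, map_eq_zero_iff _ toK_inj]

theorem D_toK (p : ℂ[X]) : D (toK p) = p.natDegree := RatFunc.intDegree_polynomial

theorem exists_iota (f : ℂ[X]) (hf : 1 ≤ f.natDegree) :
    ∃ ι : K →+* K, ∀ p, ι (toK p) = toK (p.comp f) := by
  have hinj : Function.Injective (toK.comp (compRingHom f)) := by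
    rw [injective_iff_map_eq_zero]
    intro p hp
    by_contra h0
    have h1 : p.comp f = 0 := by
      have := (map_eq_zero_iff _ toK_inj).1 hp
      simpa using this
    rcases comp_eq_zero_iff.1 h1 with h | h
    · exact h0 h
    · rw [h.2] at hf; simp at hf
  refine ⟨IsFractionRing.lift hinj, fun p => ?_⟩
  rw [IsFractionRing.lift_algebraMap]; simp

variable {f g : ℂ[X]} {ι : K →+* K}

theorem D_iota (hι : ∀ p, ι (toK p) = toK (p.comp f)) {c : K} (hc : c ≠ 0) :
    (f.natDegree : ℤ) ∣ D (ι c) := by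
  obtain ⟨a, b, hb, rfl⟩ := IsFractionRing.div_surjective (A := ℂ[X]) c
  have ha0 : toK a ≠ 0 := by
    intro h; apply hc; rw [h, zero_div]
  have hb0 : toK b ≠ 0 := by
    intro h; apply hc; rw [h, div_zero]
  have h1 : ι (toK a) ≠ 0 := by simpa using ha0
  have h2 : ι (toK b) ≠ 0 := by simpa using hb0
  rw [map_div₀, D, RatFunc.intDegree_div h1 h2]
  change _ ∣ D _ - D _
  rw [hι, hι, D_toK, D_toK, natDegree_comp, natDegree_comp]
  push_cast
  exact dvd_sub (Dvd.intro_left _ rfl) (Dvd.intro_left _ rfl)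

theorem ev_map (hι : ∀ p, ι (toK p) = toK (p.comp f)) (P : ℂ[X][X]) :
    ev ι (toK g) (P.map toK) = toK (evR f g P) := by
  simp only [coe_eval₂RingHom, eval₂_map]
  rw [hom_eval₂]
  congr 1
  exact RingHom.ext fun p => hι p

theorem good_one (hι : ∀ p, ι (toK p) = toK (p.comp f)) (G : K) : Good ι G 1 f.natDegree := by
  intro P h0 hd
  have hP : P = C (P.coeff 0) := eq_C_of_degree_le_zero (Nat.WithBot.lt_one_iff_le_zero.1 hd)
  have hc : P.coeff 0 ≠ 0 := by
    intro h; rw [h, C_0] at hP; exact h0 hP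
  have : ev ι G P = ι (P.coeff 0) := by
    conv_lhs => rw [hP]
    simp
  rw [this]
  exact ⟨by simpa using hc, D_iota hι hc⟩

theorem reduce (hf : 1 ≤ f.natDegree) (a : ℂ[X]) :
    ∃ A : ℕ → ℂ[X], a = ∑ j ∈ Finset.range f.natDegree, (A j).comp f * X ^ j := by
  have hf0 : f ≠ 0 := by rintro rfl; simp at hf
  have hl : f.leadingCoeff ≠ 0 := leadingCoeff_ne_zero.2 hf0
  set φ := f * C f.leadingCoeff⁻¹ with hφ
  have hm : φ.Monic := monic_mul_leadingCoeff_inv hf0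
  have hk : φ.natDegree = f.natDegree := natDegree_mul_leadingCoeff_inv f hf0
  obtain ⟨p, hp, h⟩ := expand φ hm _ hk (a.natDegree + 1) a (by
    refine degree_le_natDegree.trans_lt ?_
    norm_cast
    nlinarith)
  refine ⟨fun j => ∑ i ∈ Finset.range (a.natDegree + 1), C ((p i).coeff j) * (X * C f.leadingCoeff⁻¹) ^ i, ?_⟩
  have h2 : ∀ i, p i = ∑ j ∈ Finset.range f.natDegree, C ((p i).coeff j) * X ^ j := by
    intro i
    by_cases h0 : p i = 0
    · simp [h0]
    exact as_sum_range_C_mul_X_pow' _ ((natDegree_lt_iff_degree_lt h0).2 (hp i))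
  have h3 : a = ∑ i ∈ Finset.range (a.natDegree + 1), ∑ j ∈ Finset.range f.natDegree,
      C ((p i).coeff j) * X ^ j * φ ^ i := by
    conv_lhs => rw [h]
    apply Finset.sum_congr rfl
    intro i _
    conv_lhs => rw [h2 i]
    rw [Finset.sum_mul]
  rw [Finset.sum_comm] at h3
  refine h3.trans ?_
  apply Finset.sum_congr rfl
  intro j _
  simp only [← coe_compRingHom_apply, map_sum]
  rw [Finset.sum_mul]
  apply Finset.sum_congr rfl
  intro i _
  simp only [coe_compRingHom_apply, mul_comp, C_comp, pow_comp, X_comp]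
  rw [hφ]; ring

theorem exists_Q (hf : 1 ≤ f.natDegree) (g : ℂ[X]) :
    ∃ Q : ℂ[X][X], Q.Monic ∧ Q.natDegree = f.natDegree ∧ evR f g Q = 0 := by
  choose A hA using fun i : ℕ => reduce hf (g * X ^ i)
  let M : Matrix (Fin f.natDegree) (Fin f.natDegree) ℂ[X] := fun i j => A i j
  refine ⟨M.charpoly, M.charpoly_monic, by simp, ?_⟩
  have h1 : evR f g M.charpoly = (M.map (compRingHom f)).charpoly.eval g := by
    rw [Matrix.charpoly_map, eval_map]; rfl
  rw [h1, Matrix.eval_charpoly, ← Matrix.exists_mulVec_eq_zero_iff]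
  refine ⟨fun i => X ^ (i : ℕ), ?_, ?_⟩
  · intro h
    have := congrFun h ⟨0, hf⟩
    simp at this
  · ext1 i
    rw [Matrix.sub_mulVec, Pi.sub_apply, Pi.zero_apply, sub_eq_zero]
    have : ((Matrix.scalar (Fin f.natDegree)) g).mulVec (fun i => X ^ (i : ℕ)) i = g * X ^ (i : ℕ) := by
      simp [Matrix.scalar_apply, Matrix.mulVec_diagonal]
    rw [this, hA i, Finset.sum_range]
    simp [Matrix.mulVec, dotProduct, M]
    rfl

theorem inj (hι : ∀ p, ι (toK p) = toK (p.comp f))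
    (hs : Function.Surjective (evR f g)) (P : ℂ[X][X]) (h0 : P ≠ 0)
    (hd : P.degree < (f.natDegree : WithBot ℕ)) : evR f g P ≠ 0 := by
  intro hev
  set n := f.natDegree with hn
  set PF := P.map toK with hPF
  have hPF0 : PF ≠ 0 := (Polynomial.map_ne_zero_iff toK_inj).2 h0
  set Pm := PF * C PF.leadingCoeff⁻¹ with hPm
  have hm : Pm.Monic := monic_mul_leadingCoeff_inv hPF0
  have hdeg : Pm.natDegree = P.natDegree := by
    rw [hPm, natDegree_mul_leadingCoeff_inv _ hPF0, hPF, natDegree_map_eq_of_injective toK_inj]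
  have hlt : P.natDegree < n := (natDegree_lt_iff_degree_lt h0).2 hd
  have hevm : ev ι (toK g) Pm = 0 := by
    rw [hPm, map_mul, hPF, ev_map hι, hev, map_zero, zero_mul]
  choose R hR using fun r : ℕ => hs (X ^ r)
  let a : ℕ → K[X] := fun r => (R r).map toK %ₘ Pm
  have ha : ∀ r, ev ι (toK g) (a r) = toK (X ^ r) := by
    intro r
    have := congrArg (ev ι (toK g)) (modByMonic_add_div ((R r).map toK) Pm)
    rw [map_add, map_mul, hevm, zero_mul, add_zero, ev_map hι, hR] at this
    exact this
  have had : ∀ r, a r ∈ degreeLT K P.natDegree := by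
    intro r
    rw [mem_degreeLT, ← hdeg, ← degree_eq_natDegree hm.ne_zero]
    exact degree_modByMonic_lt _ hm
  have hli : LinearIndependent K (fun r : Fin n => (⟨a r, had r⟩ : degreeLT K P.natDegree)) := by
    rw [Fintype.linearIndependent_iff]
    intro c hc
    by_contra hcon
    push Not at hcon
    obtain ⟨r0, hr0⟩ := hcon
    let c' : ℕ → K := fun r => if h : r < n then c ⟨r, h⟩ else 0
    have hsum : ∑ r ∈ Finset.range n, ι (c' r) * toK (X ^ r) = 0 := by
      have h1 : ∑ r : Fin n, C (c r) * a r = 0 := by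
        have := congrArg Subtype.val hc
        simp only [AddSubmonoidClass.coe_finsetSum, SetLike.val_smul, ZeroMemClass.coe_zero] at this
        rw [← this]
        apply Finset.sum_congr rfl
        intro i _
        rw [smul_eq_C_mul]
      have h2 := congrArg (ev ι (toK g)) h1
      rw [map_sum, map_zero] at h2
      rw [Finset.sum_range, ← h2]
      apply Finset.sum_congr rfl
      intro i _
      rw [map_mul, ha]
      simp [c']
    have hD : ∀ r, ι (c' r) * toK (X ^ r) ≠ 0 → ∃ z : ℤ, D (ι (c' r) * toK (X ^ r)) = n * z + r := by
      intro r hr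
      have h3 : ι (c' r) ≠ 0 := left_ne_zero_of_mul hr
      rw [D_mul h3 (right_ne_zero_of_mul hr), D_toK, natDegree_X_pow]
      obtain ⟨z, hz⟩ := D_iota hι (c := c' r) (by intro h; apply h3; rw [h, map_zero])
      exact ⟨z, by rw [hz]⟩
    refine (D_sum (s := Finset.range n) (a := fun r => ι (c' r) * toK (X ^ r)) ?_ ?_).1 hsum
    · intro i hi j hj h1 h2 h
      obtain ⟨z, hz⟩ := hD i h1
      obtain ⟨z', hz'⟩ := hD j h2
      rw [hz, hz'] at h
      simp only [Finset.mem_range] at hi hj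
      have h5 := congrArg (· % (n : ℤ)) h
      simp only [Int.mul_add_emod_self_left] at h5
      rw [Int.emod_eq_of_lt (by omega) (by omega), Int.emod_eq_of_lt (by omega) (by omega)] at h5
      exact_mod_cast h5
    · refine ⟨r0, by simp, mul_ne_zero ?_ (toK_ne.2 (pow_ne_zero _ X_ne_zero))⟩
      simpa [c'] using hr0
  have h1 := hli.fintype_card_le_finrank
  rw [(degreeLTEquiv K P.natDegree).finrank_eq] at h1
  simp at h1
  omega

theorem exists_phi (hf : 1 ≤ f.natDegree) (hι : ∀ p, ι (toK p) = toK (p.comp f))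
    (hs : Function.Surjective (evR f g)) {k d : ℕ} (hkd : k * d = f.natDegree) (hd : 2 ≤ d)
    (hG : Good ι (toK g) k d) :
    ∃ φ : K[X], φ.Monic ∧ φ.natDegree = k ∧ ev ι (toK g) φ ≠ 0 ∧ 
      ¬ (d : ℤ) ∣ D (ev ι (toK g) φ) := by
  by_contra hcon
  push Not at hcon
  have hk0 : 1 ≤ k := by
    rcases Nat.eq_zero_or_pos k with h | h
    · subst h; omega
    · exact h
  have hkn : k + 1 ≤ f.natDegree := by nlinarith
  have hinj : ∀ P : ℂ[X][X], P ≠ 0 → P.degree < ((k + 1 : ℕ) : WithBot ℕ) → evR f g P ≠ 0 :=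
    fun P h0 hP => inj hι hs P h0 (hP.trans_le (by exact_mod_cast hkn))
  have hdiv : ∀ P : ℂ[X][X], P ≠ 0 → P.degree < ((k + 1 : ℕ) : WithBot ℕ) →
      d ∣ (evR f g P).natDegree := by
    intro P h0 hP
    have hPF0 : P.map toK ≠ 0 := (Polynomial.map_ne_zero_iff toK_inj).2 h0
    have hPe : ev ι (toK g) (P.map toK) ≠ 0 := by
      rw [ev_map hι, toK_ne]; exact hinj P h0 hP
    have hPD : D (ev ι (toK g) (P.map toK)) = (evR f g P).natDegree := by
      rw [ev_map hι, D_toK]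
    suffices (d : ℤ) ∣ D (ev ι (toK g) (P.map toK)) by
      rw [hPD] at this; exact_mod_cast this
    by_cases hlt : P.degree < (k : WithBot ℕ)
    · exact (hG _ hPF0 (degree_map_le.trans_lt hlt)).2
    have hnd : P.natDegree = k := by
      have h1 := (natDegree_lt_iff_degree_lt h0).2 hP
      rw [← natDegree_lt_iff_degree_lt h0] at hlt
      omega
    have hlc : (P.map toK).leadingCoeff⁻¹ ≠ 0 := inv_ne_zero (leadingCoeff_ne_zero.2 hPF0)
    have hlc' : ι (P.map toK).leadingCoeff⁻¹ ≠ 0 := by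
      rw [ne_eq, map_eq_zero]; exact hlc
    have he : ev ι (toK g) (P.map toK * C (P.map toK).leadingCoeff⁻¹) =
        ev ι (toK g) (P.map toK) * ι (P.map toK).leadingCoeff⁻¹ := by
      rw [map_mul]; congr 1; simp
    have h2 := hcon (P.map toK * C (P.map toK).leadingCoeff⁻¹) (monic_mul_leadingCoeff_inv hPF0)
      (by rw [natDegree_mul_leadingCoeff_inv _ hPF0, natDegree_map_eq_of_injective toK_inj, hnd])
      (by rw [he]; exact mul_ne_zero hPe hlc')
    rw [he, D_mul hPe hlc'] at h2
    have h3 : (d : ℤ) ∣ D (ι (P.map toK).leadingCoeff⁻¹) :=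
      dvd_trans ⟨(k : ℤ), by rw [← hkd]; push_cast; ring⟩ (D_iota hι hlc)
    exact (dvd_add_left h3).1 h2
  set n := f.natDegree with hn
  let S : ℕ → ℂ[X][X] → Prop := fun r P => P ≠ 0 ∧ P.degree < ((k + 1 : ℕ) : WithBot ℕ) ∧
    (evR f g P).natDegree % n = r * d
  have hch : ∀ r : ℕ, ∃ P : ℂ[X][X], (∃ P', S r P') → S r P ∧
      ∀ P', S r P' → (evR f g P).natDegree ≤ (evR f g P').natDegree := by
    intro r
    by_cases h : ∃ P', S r P'
    · classical
      have hex : ∃ N, ∃ P', S r P' ∧ (evR f g P').natDegree = N := by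
        obtain ⟨P', hP'⟩ := h; exact ⟨_, P', hP', rfl⟩
      obtain ⟨P, hP, hPN⟩ := Nat.find_spec hex
      refine ⟨P, fun _ => ⟨hP, fun P' hP' => ?_⟩⟩
      rw [hPN]
      exact Nat.find_min' hex ⟨P', hP', rfl⟩
    · exact ⟨0, fun h' => absurd h' h⟩
  choose B hB using hch
  classical
  set w : Finset ℂ[X][X] := (Finset.range k).image B with hw
  have hspan : ∀ m : ℕ, ∀ P : ℂ[X][X], P.degree < ((k + 1 : ℕ) : WithBot ℕ) →
      (evR f g P).degree < (m : WithBot ℕ) → P ∈ Submodule.span ℂ[X] (w : Set ℂ[X][X]) := by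
    intro m
    induction m with
    | zero =>
      intro P hP hm
      by_cases h0 : P = 0
      · rw [h0]; exact Submodule.zero_mem _
      · exfalso
        apply hinj P h0 hP
        simpa using hm
    | succ m ih =>
      intro P hP hm
      by_cases h0 : P = 0
      · rw [h0]; exact Submodule.zero_mem _
      have he0 := hinj P h0 hP
      obtain ⟨q, hq⟩ := hdiv P h0 hP
      set N := (evR f g P).natDegree with hN
      obtain ⟨r, hr⟩ : d ∣ N % n := (Nat.dvd_mod_iff ⟨k, by rw [← hkd]; ring⟩).2 ⟨q, hq⟩
      have hrk : r < k := by
        have : N % n < n := Nat.mod_lt _ (by omega)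
        rw [hr, ← hkd, mul_comm] at this
        exact Nat.lt_of_mul_lt_mul_right this
      have hSP : S r P := ⟨h0, hP, by rw [← hN, hr, mul_comm]⟩
      obtain ⟨⟨hb0, hbd, hbm⟩, hmin⟩ := hB r ⟨P, hSP⟩
      have hle := hmin P hSP
      have hbe := hinj _ hb0 hbd
      set N0 := (evR f g (B r)).natDegree with hN0
      obtain ⟨l, hl⟩ : n ∣ N - N0 := (Nat.modEq_iff_dvd' hle).1 (by
        change N0 % n = N % n; rw [hbm, hr, mul_comm])
      have hf0 : f ≠ 0 := by rintro rfl; simp at hn; omega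
      set s := f ^ l * evR f g (B r) with hs'
      have hs0 : s ≠ 0 := mul_ne_zero (pow_ne_zero _ hf0) hbe
      have hsd : s.natDegree = N := by
        rw [hs', natDegree_mul (pow_ne_zero _ hf0) hbe, natDegree_pow, ← hN0, ← hn, mul_comm l, ← hl]
        omega
      set c := (evR f g P).leadingCoeff / s.leadingCoeff with hc
      have hslc : s.leadingCoeff ≠ 0 := leadingCoeff_ne_zero.2 hs0
      have hc0 : c ≠ 0 := div_ne_zero (leadingCoeff_ne_zero.2 he0) hslc
      have hevc : evR f g ((C c * X ^ l : ℂ[X]) • B r) = C c * s := by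
        have h7 : ∀ a : ℂ[X], evR f g (C a) = a.comp f := fun a => by simp
        rw [smul_eq_C_mul, map_mul, hs', h7]
        simp [mul_assoc]
      have hlt : (evR f g (P - (C c * X ^ l : ℂ[X]) • B r)).degree < (evR f g P).degree := by
        rw [map_sub, hevc]
        apply degree_sub_lt_left _ he0
        · rw [leadingCoeff_mul, leadingCoeff_C, hc, div_mul_cancel₀ _ hslc]
        · rw [degree_C_mul hc0, degree_eq_natDegree he0, degree_eq_natDegree hs0, hsd]
      have hPm : (evR f g P).degree ≤ (m : WithBot ℕ) := by
        rw [degree_eq_natDegree he0] at hm ⊢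
        norm_cast at hm ⊢
        omega
      have hsmul : ((C c * X ^ l : ℂ[X]) • B r).degree < ((k + 1 : ℕ) : WithBot ℕ) :=
        (degree_smul_le _ _).trans_lt hbd
      have hmem := ih _ ((degree_sub_le _ _).trans_lt (max_lt hP hsmul)) (hlt.trans_le hPm)
      have := Submodule.add_mem _ hmem (Submodule.smul_mem _ (C c * X ^ l : ℂ[X])
        (Submodule.subset_span (show B r ∈ (w : Set ℂ[X][X]) by
          rw [hw]; simp only [Finset.coe_image, Finset.coe_range]; exact ⟨r, hrk, rfl⟩)))
      rwa [sub_add_cancel] at this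
  have hli : LinearIndependent ℂ[X] (fun i : Fin (k + 1) => (X ^ (i : ℕ) : ℂ[X][X])) := by
    have h1 := (Polynomial.basisMonomials ℂ[X]).linearIndependent.comp (fun i : Fin (k + 1) => (i : ℕ))
      Fin.val_injective
    convert h1 using 1
    ext1 i
    simp [X_pow_eq_monomial]
  have hcard := linearIndependent_le_span_aux' _ hli (w : Set ℂ[X][X]) (by
    rintro _ ⟨i, rfl⟩
    refine hspan ((evR f g (X ^ (i : ℕ))).natDegree + 1) _ ?_ ?_
    · rw [degree_X_pow]; exact_mod_cast i.2
    · exact degree_le_natDegree.trans_lt (by exact_mod_cast Nat.lt_succ_self _))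
  simp only [Fintype.card_fin, Finset.coe_sort_coe, Fintype.card_coe] at hcard
  have : w.card ≤ k := by
    have := Finset.card_image_le (s := Finset.range k) (f := B)
    simpa [hw] using this
  omega

end AMS

end

section
open Polynomial
namespace AMS
variable {f g : ℂ[X]} {ι : K →+* K}

theorem uu (hf : 1 ≤ f.natDegree) (hι : ∀ p, ι (toK p) = toK (p.comp f))
    (hs : Function.Surjective (evR f g)) : ∀ d k : ℕ, k * d = f.natDegree →
    Good ι (toK g) k d →
    (∃ φ : ℂ[X][X], φ.Monic ∧ φ.natDegree = k ∧ ((d = 1 ∧ evR f g φ = 0) ∨ 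
      (evR f g φ ≠ 0 ∧ ¬ d ∣ (evR f g φ).natDegree))) ∧
    ∀ N : ℕ, ∃ P : ℂ[X][X], P.degree < (k : WithBot ℕ) ∧ evR f g P ≠ 0 ∧
      (evR f g P).natDegree = d * N := by
  intro d
  induction d using Nat.strong_induction_on with
  | _ d ih =>
  intro k hkd hG
  have hd0 : 1 ≤ d := by
    rcases Nat.eq_zero_or_pos d with h | h
    · subst h; omega
    · exact h
  have hk0 : 1 ≤ k := by
    rcases Nat.eq_zero_or_pos k with h | h
    · subst h; omega
    · exact h
  rcases Nat.eq_or_lt_of_le hd0 with h1 | h2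
  · subst h1
    rw [mul_one] at hkd
    obtain ⟨Q, hQm, hQd, hQ0⟩ := exists_Q hf g
    refine ⟨⟨Q, hQm, by rw [hQd, hkd], Or.inl ⟨rfl, hQ0⟩⟩, fun N => ?_⟩
    obtain ⟨P, hP⟩ := hs (X ^ N)
    have he : evR f g (P %ₘ Q) = X ^ N := by
      have := congrArg (evR f g) (modByMonic_add_div P Q)
      rw [map_add, map_mul, hQ0, zero_mul, add_zero, hP] at this
      exact this
    refine ⟨P %ₘ Q, ?_, ?_, ?_⟩
    · rw [hkd, ← hQd, ← degree_eq_natDegree hQm.ne_zero]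
      exact degree_modByMonic_lt _ hQm
    · rw [he]; exact pow_ne_zero _ X_ne_zero
    · rw [he, natDegree_X_pow, one_mul]
  · obtain ⟨φ, hm, hk, hφ0, hnd⟩ := exists_phi hf hι hs hkd h2 hG
    obtain ⟨e, d', he2, hde, hG', hd'δ, hi⟩ := good_step hG hd0 hm hk hφ0 rfl hnd
    have hd'0 : 0 < d' := by
      rcases Nat.eq_zero_or_pos d' with h | h
      · subst h; omega
      · exact h
    obtain ⟨⟨Φ, hΦm, hΦk, hΦ⟩, hT⟩ := ih d' (by rw [hde]; nlinarith) (e * k)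
      (by rw [← hkd, hde]; ring) hG'
    obtain ⟨ψ, hψm, hψk, hψ0, hψD, hψd⟩ := improve hG he2 hG' hi (Φ := Φ.map toK) (hΦm.map _)
      (by rw [natDegree_map_eq_of_injective toK_inj, hΦk]) (by
        rw [ev_map hι]
        rcases hΦ with h | h
        · left; rw [h.2, map_zero]
        · right; rw [D_toK]; exact_mod_cast h.2) hm hk hφ0 rfl
    have heC : ((e : ℕ) : ℂ[X]) * C ((e : ℂ)⁻¹) = 1 := by
      rw [← map_natCast C, ← C_mul, mul_inv_cancel₀ (by exact_mod_cast (by omega)), C_1]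
    obtain ⟨χ, hχm, hχk, hχd⟩ := approx_exists Φ k e hΦm hΦk he2 _ heC
    have heq : χ.map toK = ψ := by
      refine approx_unique (χ.map toK) ψ (Φ.map toK) (hχm.map _) hψm k e
        (by rw [natDegree_map_eq_of_injective toK_inj, hχk]) hψk (by omega) ?_ hψd
      rw [← Polynomial.map_pow, ← Polynomial.map_sub]
      exact degree_map_le.trans_lt hχd
    subst heq
    refine ⟨⟨χ, hχm, hχk, Or.inr ⟨?_, ?_⟩⟩, ?_⟩
    · rwa [ev_map hι, toK_ne] at hψ0
    · rw [← hψD, ev_map hι, D_toK] at hnd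
      exact_mod_cast hnd
    · intro N
      obtain ⟨P, hPd, hP0, hPN⟩ := hT (e * N)
      obtain ⟨p, hp, hPp⟩ := expand χ hχm k hχk e P hPd
      have hmap : P.map toK = ∑ i ∈ Finset.range e, (p i).map toK * (χ.map toK) ^ i := by
        rw [hPp, Polynomial.map_sum]
        simp only [Polynomial.map_mul, Polynomial.map_pow]
      obtain ⟨h1, i, hie, hi0, hD, -⟩ := dist hG hψ0 hψD hi (fun i => (p i).map toK)
        (fun i => degree_map_le.trans_lt (hp i)) (by
          by_contra hc
          push Not at hc
          apply hP0
          rw [hPp, Finset.sum_eq_zero, map_zero]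
          intro i hi'
          rw [(Polynomial.map_eq_zero_iff toK_inj).1 (hc i (by simpa using hi')), zero_mul])
      rw [← hmap, ev_map hι, D_toK, hPN] at hD
      obtain ⟨h3, h4⟩ := hG _ hi0 (degree_map_le.trans_lt (hp i))
      have hi00 : i = 0 := by
        by_contra hne
        apply hi i (by omega) hie
        have : (i : ℤ) * D (ev ι (toK g) φ) = ((d' * (e * N) : ℕ) : ℤ) - D (ev ι (toK g) ((p i).map toK)) := by
          rw [hD]; ring
        rw [this]
        apply dvd_sub _ h4
        exact ⟨N, by rw [hde]; push_cast; ring⟩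
      subst hi00
      rw [ev_map hι] at h3 hD
      refine ⟨p 0, hp 0, toK_ne.1 h3, ?_⟩
      rw [D_toK] at hD
      simp only [Nat.cast_zero, zero_mul, add_zero] at hD
      have : d' * (e * N) = (evR f g (p 0)).natDegree := by exact_mod_cast hD
      rw [← this, hde]; ring

theorem main_red (hf : 2 ≤ f.natDegree) (hs : Function.Surjective (evR f g)) :
    ∃ p : ℂ[X], (g + p.comp f).natDegree < f.natDegree := by
  obtain ⟨ι, hι⟩ := exists_iota f (by omega)
  have hG := good_one hι (toK g)
  obtain ⟨⟨φ, hm, hk, hφ⟩, -⟩ := uu (by omega) hι hs f.natDegree 1 (by ring) hG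
  rcases hφ with hφ | ⟨hφ0, hnd⟩
  · omega
  have h0' : ev ι (toK g) (φ.map toK) ≠ 0 := by rw [ev_map hι, toK_ne]; exact hφ0
  have hδ : D (ev ι (toK g) (φ.map toK)) = (evR f g φ).natDegree := by rw [ev_map hι, D_toK]
  set δ := (evR f g φ).natDegree with hδ'
  obtain ⟨e, d', he2, hde, hG', hd'δ, hi⟩ := good_step hG (by omega) (hm.map toK)
    (by rw [natDegree_map_eq_of_injective toK_inj, hk]) h0' hδ (by exact_mod_cast hnd)
  obtain ⟨-, hT⟩ := uu (by omega) hι hs d' (e * 1) (by rw [mul_one, ← hde]) hG'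
  have hd'0 : 0 < d' := by
    rcases Nat.eq_zero_or_pos d' with h | h
    · subst h; omega
    · exact h
  have hd'n : d' < f.natDegree := by rw [hde]; nlinarith
  obtain ⟨P, hPd, hP0, hPN⟩ := hT 1
  obtain ⟨p, hp, hPp⟩ := expand φ hm 1 hk e P hPd
  have hmap : P.map toK = ∑ i ∈ Finset.range e, (p i).map toK * (φ.map toK) ^ i := by
    rw [hPp, Polynomial.map_sum]
    simp only [Polynomial.map_mul, Polynomial.map_pow]
  obtain ⟨h1, i, hie, hi0, hD, -⟩ := dist hG h0' hδ hi (fun i => (p i).map toK)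
    (fun i => degree_map_le.trans_lt (hp i)) (by
      by_contra hc
      push Not at hc
      apply hP0
      rw [hPp, Finset.sum_eq_zero, map_zero]
      intro i hi'
      rw [(Polynomial.map_eq_zero_iff toK_inj).1 (hc i (by simpa using hi')), zero_mul])
  rw [← hmap, ev_map hι, D_toK, hPN, ev_map hι, D_toK] at hD
  obtain ⟨h3, h4⟩ := hG _ hi0 (degree_map_le.trans_lt (hp i))
  rw [ev_map hι, D_toK] at h4
  have h5 : f.natDegree ∣ (evR f g (p i)).natDegree := by exact_mod_cast h4
  have h6 : d' * 1 = (evR f g (p i)).natDegree + i * δ := by exact_mod_cast hD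
  have h7 : (evR f g (p i)).natDegree = 0 := Nat.eq_zero_of_dvd_of_lt h5 (by omega)
  have hi1 : 1 ≤ i := by
    rcases Nat.eq_zero_or_pos i with h | h
    · subst h; omega
    · exact h
  have hlt : δ < f.natDegree := by nlinarith
  refine ⟨φ.coeff 0, ?_⟩
  have hφe : φ = X + C (φ.coeff 0) := by
    have h8 := hm.coeff_natDegree
    rw [hk] at h8
    conv_lhs => rw [eq_X_add_C_of_natDegree_le_one hk.le, h8]
    simp
  have : evR f g φ = g + (φ.coeff 0).comp f := by
    conv_lhs => rw [hφe]
    simp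
  rw [← this]; exact hlt
end AMS

end

open MvPolynomial
namespace AMS
abbrev M := MvPolynomial (Fin 2) ℂ

def Z (q : M) : Prop := ∀ s : ℂ, ∃ τ : M ≃ₐ[ℂ] M, τ q = q + C s

theorem Z_transport (σ : M ≃ₐ[ℂ] M) {q : M} (h : Z (σ q)) : Z q := by
  intro s
  obtain ⟨τ, hτ⟩ := h s
  refine ⟨σ.trans (τ.trans σ.symm), ?_⟩
  have h1 : σ (C s) = C s := σ.commutes s
  simp only [AlgEquiv.trans_apply]
  rw [hτ, ← h1, ← map_add, AlgEquiv.symm_apply_apply, h1]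

noncomputable def shearHom (p : Polynomial ℂ) : M →ₐ[ℂ] M :=
  aeval ![X 0, X 1 + Polynomial.aeval (X 0 : M) p]

theorem shear0 (p : Polynomial ℂ) : shearHom p (X 0) = X 0 := by simp [shearHom]
theorem shear1 (p : Polynomial ℂ) : shearHom p (X 1) = X 1 + Polynomial.aeval (X 0 : M) p := by
  simp [shearHom]
theorem shear_aeval (p r : Polynomial ℂ) :
    shearHom p (Polynomial.aeval (X 0 : M) r) = Polynomial.aeval (X 0 : M) r := by
  rw [← Polynomial.aeval_algHom_apply, shear0]

theorem shear_comp (p r : Polynomial ℂ) (h : p + r = 0) :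
    (shearHom p).comp (shearHom r) = AlgHom.id ℂ M := by
  apply MvPolynomial.algHom_ext
  intro i
  fin_cases i
  · simp [shear0]
  · simp only [Fin.mk_one, AlgHom.comp_apply, AlgHom.id_apply, shear1, map_add, shear_aeval]
    rw [add_assoc, ← map_add, h, map_zero, add_zero]

noncomputable def shear (p : Polynomial ℂ) : M ≃ₐ[ℂ] M :=
  AlgEquiv.ofAlgHom (shearHom p) (shearHom (-p)) (shear_comp _ _ (by ring)) (shear_comp _ _ (by ring))

theorem shear_apply (p : Polynomial ℂ) (x : M) : shear p x = shearHom p x := rfl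

noncomputable def sw : M ≃ₐ[ℂ] M := renameEquiv ℂ (Equiv.swap 0 1)

theorem sw0 : sw (X 0) = X 1 := by simp [sw]
theorem sw1 : sw (X 1) = X 0 := by simp [sw]

theorem surj_evR (π : M →ₐ[ℂ] Polynomial ℂ) (hs : Function.Surjective π) :
    Function.Surjective (evR (π (X 0)) (π (X 1))) := by
  intro a
  obtain ⟨P, rfl⟩ := hs a
  refine ⟨eval₂Hom (Polynomial.C.comp Polynomial.C) ![Polynomial.C Polynomial.X, Polynomial.X] P, ?_⟩
  have : (evR (π (X 0)) (π (X 1))).comp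
      (eval₂Hom (Polynomial.C.comp Polynomial.C) ![Polynomial.C Polynomial.X, Polynomial.X])
      = (π : M →+* Polynomial ℂ) := by
    apply MvPolynomial.ringHom_ext
    · intro r
      have : π (C r) = Polynomial.C r := π.commutes r
      simp [this]
    · intro i
      fin_cases i <;> simp
  exact congrArg (fun h : M →+* Polynomial ℂ => h P) this

theorem ker_transport (σ : M ≃ₐ[ℂ] M) {q : M} (π : M →ₐ[ℂ] Polynomial ℂ)
    (hk : ∀ P, π P = 0 ↔ q ∣ P) :
    ∀ P, (π.comp (σ : M →ₐ[ℂ] M)) P = 0 ↔ σ.symm q ∣ P := by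
  intro P
  change π (σ P) = 0 ↔ _
  rw [hk, ← map_dvd_iff σ.symm, AlgEquiv.symm_apply_apply]

theorem surj_transport (σ : M ≃ₐ[ℂ] M) (π : M →ₐ[ℂ] Polynomial ℂ)
    (hs : Function.Surjective π) : Function.Surjective (π.comp (σ : M →ₐ[ℂ] M)) :=
  hs.comp σ.surjective

theorem pi_aeval (π : M →ₐ[ℂ] Polynomial ℂ) (p : Polynomial ℂ) :
    π (Polynomial.aeval (X 0 : M) p) = p.comp (π (X 0)) := by
  rw [← Polynomial.aeval_algHom_apply, Polynomial.comp_eq_aeval]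

theorem base (q : M) (π : M →ₐ[ℂ] Polynomial ℂ) 
    (hk : ∀ P, π P = 0 ↔ q ∣ P) (hd : (π (X 0)).natDegree = 1) : Z q := by
  obtain ⟨p, hp⟩ : ∃ p : Polynomial ℂ, p.comp (π (X 0)) = π (X 1) := by
    set f := π (X 0)
    have hf := Polynomial.eq_X_add_C_of_natDegree_le_one hd.le
    have ha : f.coeff 1 ≠ 0 := by
      intro h; rw [h] at hf; rw [hf] at hd; simp at hd
    refine ⟨(π (X 1)).comp (Polynomial.C (f.coeff 1)⁻¹ * (Polynomial.X - Polynomial.C (f.coeff 0))), ?_⟩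
    rw [Polynomial.comp_assoc]
    have : (Polynomial.C (f.coeff 1)⁻¹ * (Polynomial.X - Polynomial.C (f.coeff 0))).comp f
        = Polynomial.X := by
      simp only [Polynomial.mul_comp, Polynomial.C_comp, Polynomial.sub_comp, Polynomial.X_comp]
      conv_lhs => rw [hf]
      simp only [Polynomial.coeff_add, Polynomial.coeff_C_mul, Polynomial.coeff_X_one, mul_one,
        Polynomial.coeff_C_succ, add_zero, Polynomial.coeff_C_zero, Polynomial.coeff_X_zero,
        mul_zero, zero_add, add_sub_cancel_right]
      rw [← mul_assoc, ← Polynomial.C_mul, inv_mul_cancel₀ ha, Polynomial.C_1, one_mul]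
    rw [this, Polynomial.comp_X]
  set σ := shear (-p)
  have hk' := ker_transport σ π hk
  apply Z_transport σ.symm
  set q' := σ.symm q
  have h1 : q' ∣ X 1 := by
    rw [← hk']
    change π (shear (-p) (X 1)) = 0
    rw [shear_apply, shear1, map_add, pi_aeval, Polynomial.neg_comp, hp, add_neg_cancel]
  obtain ⟨r, hr⟩ := h1
  have hirr : Irreducible (X 1 : M) := Prime.irreducible MvPolynomial.X_prime
  have hq : ¬ IsUnit q' := by
    intro h
    have := (hk' 1).2 h.dvd
    simp at this
  have hru : IsUnit r := (hirr.isUnit_or_isUnit hr).resolve_left hq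
  obtain ⟨u, hu, rfl⟩ := MvPolynomial.isUnit_iff_eq_C_of_isReduced.1 hru
  have hu0 : u ≠ 0 := hu.ne_zero
  have hq' : q' = C u⁻¹ * X 1 := by
    rw [hr, mul_left_comm, ← C_mul, inv_mul_cancel₀ hu0, C_1, mul_one]
  intro s
  refine ⟨shear (Polynomial.C (u * s)), ?_⟩
  rw [hq', shear_apply, map_mul, shear1]
  have h2 : shearHom (Polynomial.C (u * s)) (C u⁻¹) = C u⁻¹ := (shearHom _).commutes _
  rw [h2, Polynomial.aeval_C, mul_add]
  congr 1
  rw [MvPolynomial.algebraMap_eq, ← C_mul, ← mul_assoc, inv_mul_cancel₀ hu0, one_mul]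

theorem all (n : ℕ) : ∀ (q : M) (π : M →ₐ[ℂ] Polynomial ℂ), Function.Surjective π →
    (∀ P, π P = 0 ↔ q ∣ P) → (π (X 0)).natDegree = n → Z q := by
  induction n using Nat.strong_induction_on with
  | _ n ih =>
  intro q π hs hk hd
  have hsR := surj_evR π hs
  by_cases h1 : n = 1
  · exact base q π hk (hd.trans h1)
  by_cases h0 : n = 0
  · subst h0
    apply Z_transport sw.symm
    refine base _ _ (ker_transport sw π hk) ?_
    change (π (sw (X 0))).natDegree = 1
    rw [sw0]
    obtain ⟨P, hP⟩ := hsR Polynomial.X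
    obtain ⟨c, hc⟩ := Polynomial.natDegree_eq_zero.1 hd
    rw [← hc] at hP
    have h2 : (P.map (Polynomial.evalRingHom c)).comp (π (X 1)) = Polynomial.X := by
      rw [← hP, Polynomial.comp, Polynomial.eval₂_map]
      simp only [Polynomial.coe_eval₂RingHom]
      congr 1
      apply RingHom.ext
      intro p
      simp
    have h3 := congrArg Polynomial.natDegree h2
    rw [Polynomial.natDegree_comp, Polynomial.natDegree_X] at h3
    exact Nat.eq_one_of_mul_eq_one_left h3
  · obtain ⟨p, hp⟩ := main_red (f := π (X 0)) (g := π (X 1)) (by omega) hsR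
    set σ := sw.trans (shear p)
    apply Z_transport σ.symm
    refine ih _ ?_ _ _ (surj_transport σ π hs) (ker_transport σ π hk) rfl
    change (π (shear p (sw (X 0)))).natDegree < n
    rw [sw0, shear_apply, shear1, map_add, pi_aeval, ← hd]
    exact hp

end AMS

/-- Consequence of the Lin–Zaidenberg theorem used in Proposition 2: if the zero fiber of
`q ∈ ℂ[x,y]` is isomorphic to `ℂ`, i.e. `ℂ[x,y]/(q) ≅ ℂ[t]` as ℂ-algebras, then all
nonzero fibers of `q` are pairwise isomorphic as affine curves. -/
theorem nonzero_fibers_pairwise_isomorphic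
    (q : MvPolynomial (Fin 2) ℂ)
    (h : Nonempty ((MvPolynomial (Fin 2) ℂ ⧸ Ideal.span {q}) ≃ₐ[ℂ] Polynomial ℂ)) :
    ∀ c c' : ℂ, c ≠ 0 → c' ≠ 0 →
      Nonempty ((MvPolynomial (Fin 2) ℂ ⧸ Ideal.span {q - C c}) ≃ₐ[ℂ]
        (MvPolynomial (Fin 2) ℂ ⧸ Ideal.span {q - C c'})) := by
  obtain ⟨ψ⟩ := h
  intro c c' _ _
  have hZ : AMS.Z q := by
    refine AMS.all _ q (ψ.toAlgHom.comp (Ideal.Quotient.mkₐ ℂ (Ideal.span {q})))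
      (ψ.surjective.comp (Ideal.Quotient.mkₐ_surjective ℂ _)) ?_ rfl
    intro P
    change ψ (Ideal.Quotient.mk _ P) = 0 ↔ q ∣ P
    rw [map_eq_zero_iff ψ ψ.injective, Ideal.Quotient.eq_zero_iff_mem, Ideal.mem_span_singleton]
  obtain ⟨τ, hτ⟩ := hZ (c - c')
  refine ⟨Ideal.quotientEquivAlg _ _ τ ?_⟩
  have h1 : τ (C c) = C c := τ.commutes c
  rw [Ideal.map_span, Set.image_singleton]
  congr 2
  change q - C c' = τ (q - C c)
  rw [map_sub, hτ, h1, C_sub]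
  ring
end
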